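/- Fix d ≥ 2 and assume Pólya's conjecture for the Neumann Laplacian holds on bounded convex domains: for every k ≥ 1 and every nonempty bounded convex open set Ω' ⊂ ℝ^d, μ_k(Ω')·|Ω'|^{2/d} ≤ 4π²k^{2/d}/ω_d^{2/d}, where ω_d is the volume of the unit ball in ℝ^d and |·| is Lebesgue measure. Then for every nonempty bounded convex open set Ω ⊂ ℝ^d and every sequence (Ω_k)_{k≥1} of nonempty bounded convex open sets in ℝ^d, liminf_{k→∞} (μ_k(Ω)·|Ω|^{2/d})/(μ_k(Ω_k)·|Ω_k|^{2/d}) ≥ 1; precisely, for every ε > 0 there exists K such that for all k ≥ K, μ_k(Ω)·|Ω|^{2/d} ≥ (1 − ε)·μ_k(Ω_k)·|Ω_k|^{2/d}. -/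

import Mathlib

open MeasureTheory Real Filter

noncomputable section

/-- Euclidean space `ℝ^d`. -/
abbrev Euc (d : ℕ) := EuclideanSpace ℝ (Fin d)

/-- The Rayleigh quotient of a function `u` on a set `Ω ⊆ ℝ^d`. -/
noncomputable def rayleigh {d : ℕ} (Ω : Set (Euc d)) (u : Euc d → ℝ) : ℝ :=
  (∫ x in Ω, ‖fderiv ℝ u x‖ ^ 2) / (∫ x in Ω, (u x) ^ 2)

/-- The `k`-th Neumann eigenvalue of `Ω ⊆ ℝ^d`, defined by the variational (min-max)
principle: the infimum, over all subspaces `V` of smooth functions `ℝ^d → ℝ` whose space of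
restrictions to `Ω` is `(k+1)`-dimensional, of the supremum of the Rayleigh quotient over
the elements of `V` that are nonzero in `L²(Ω)`. -/
noncomputable def neumannEigenvalue {d : ℕ} (k : ℕ) (Ω : Set (Euc d)) : ℝ :=
  sInf { t : ℝ | ∃ V : Submodule ℝ (Euc d → ℝ),
    (∀ u ∈ V, ContDiff ℝ (⊤ : ℕ∞) u) ∧
    Module.finrank ℝ (V.map (LinearMap.funLeft ℝ ℝ ((↑) : Ω → Euc d))) = k + 1 ∧
    t = sSup { r : ℝ | ∃ u ∈ V, (0 < ∫ x in Ω, (u x) ^ 2) ∧ r = rayleigh Ω u } }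

/-- A nonempty bounded convex open subset of `ℝ^d`. -/
def IsConvexDomain {d : ℕ} (Ω : Set (Euc d)) : Prop :=
  Ω.Nonempty ∧ IsOpen Ω ∧ Bornology.IsBounded Ω ∧ Convex ℝ Ω

/-- The optimal constant `α_{k,d}`: the infimum of `μ_k(Ω₁)/μ_k(Ω₂)` over all pairs of
nonempty bounded convex open sets `Ω₁ ⊆ Ω₂ ⊂ ℝ^d`. -/
noncomputable def alphaConst (k d : ℕ) : ℝ :=
  sInf { r : ℝ | ∃ Ω₁ Ω₂ : Set (Euc d), IsConvexDomain Ω₁ ∧ IsConvexDomain Ω₂ ∧ Ω₁ ⊆ Ω₂ ∧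
    r = neumannEigenvalue k Ω₁ / neumannEigenvalue k Ω₂ }

/-- The Bessel function of the first kind of order `ν` (for `x > 0`). -/
noncomputable def besselJ (ν : ℝ) (x : ℝ) : ℝ :=
  ∑' m : ℕ, ((-1 : ℝ) ^ m / (m.factorial * Real.Gamma (m + ν + 1))) * (x / 2) ^ (2 * (m : ℝ) + ν)

/-- The first positive zero `j_{ν,1}` of the Bessel function `J_ν`. -/
noncomputable def besselZero1 (ν : ℝ) : ℝ :=
  sInf {x : ℝ | 0 < x ∧ besselJ ν x = 0}

/-- The second positive zero `j_{ν,2}` of the Bessel function `J_ν`. -/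
noncomputable def besselZero2 (ν : ℝ) : ℝ :=
  sInf {x : ℝ | besselZero1 ν < x ∧ besselJ ν x = 0}


lemma integrableOn_of_cont {d : ℕ} {A : Set (Euc d)} (hA : Bornology.IsBounded A)
    {f : Euc d → ℝ} (hf : Continuous f) : IntegrableOn f A :=
  (hf.continuousOn.integrableOn_compact (hA.isCompact_closure)).mono_set subset_closure

lemma fderiv_eq_of_eqOn {d : ℕ} {Ω : Set (Euc d)} (ho : IsOpen Ω) {u v : Euc d → ℝ}
    (h : Set.EqOn u v Ω) {x : Euc d} (hx : x ∈ Ω) : fderiv ℝ u x = fderiv ℝ v x :=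
  Filter.EventuallyEq.fderiv_eq (h.eventuallyEq_of_mem (ho.mem_nhds hx))

lemma setIntegral_sq_pos {d : ℕ} {Ω : Set (Euc d)} (ho : IsOpen Ω) (hb : Bornology.IsBounded Ω)
    {u : Euc d → ℝ} (hu : Continuous u) {x : Euc d} (hx : x ∈ Ω) (hne : u x ≠ 0) :
    0 < ∫ x in Ω, (u x) ^ 2 := by
  rw [setIntegral_pos_iff_support_of_nonneg_ae]
  · have : IsOpen (Function.support (fun x => u x ^ 2) ∩ Ω) :=
      (IsOpen.inter ((hu.pow 2).isOpen_support) ho)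
    exact this.measure_pos _ ⟨x, by simpa using hne, hx⟩
  · exact Filter.Eventually.of_forall fun x => sq_nonneg _
  · exact integrableOn_of_cont hb (hu.pow 2)

lemma exists_coeffs {d : ℕ} {Ω : Set (Euc d)} {k : ℕ} {V : Submodule ℝ (Euc d → ℝ)}
    (hfin : Module.finrank ℝ (V.map (LinearMap.funLeft ℝ ℝ ((↑) : Ω → Euc d))) = k + 1) :
    ∃ v : Fin (k+1) → Euc d → ℝ, (∀ i, v i ∈ V) ∧
      (∀ a : Fin (k+1) → ℝ, (∀ x ∈ Ω, ∑ i, a i * v i x = 0) → a = 0) ∧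
      (∀ u ∈ V, ∃ a : Fin (k+1) → ℝ, ∀ x ∈ Ω, u x = ∑ i, a i * v i x) := by
  have : FiniteDimensional ℝ (V.map (LinearMap.funLeft ℝ ℝ ((↑) : Ω → Euc d))) :=
    Module.finite_of_finrank_pos (by omega)
  let b := Module.finBasisOfFinrankEq ℝ _ hfin
  have hb : ∀ i, ∃ v ∈ V, LinearMap.funLeft ℝ ℝ ((↑) : Ω → Euc d) v = b i :=
    fun i => Submodule.mem_map.1 (b i).2
  choose v hv hvb using hb
  have hval : ∀ i (x : Ω), ((b i : _) : Ω → ℝ) x = v i x := by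
    intro i x; rw [← hvb i]; rfl
  refine ⟨v, hv, ?_, ?_⟩
  · intro a ha
    have : ∑ i, a i • b i = 0 := by
      apply Subtype.ext
      funext x
      simp only [Submodule.coe_sum, Submodule.coe_smul, Finset.sum_apply, Pi.smul_apply, hval,
        smul_eq_mul, ZeroMemClass.coe_zero, Pi.zero_apply]
      exact ha x x.2
    have hli := b.linearIndependent
    rw [Fintype.linearIndependent_iff] at hli
    funext i
    exact hli a this i
  · intro u hu
    refine ⟨fun i => b.repr ⟨_, Submodule.mem_map_of_mem hu⟩ i, fun x hx => ?_⟩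
    have h := b.sum_repr ⟨_, Submodule.mem_map_of_mem (f := LinearMap.funLeft ℝ ℝ ((↑) : Ω → Euc d)) hu⟩
    have h2 := congrFun (congrArg Subtype.val h) ⟨x, hx⟩
    simp only [Submodule.coe_sum, Submodule.coe_smul, Finset.sum_apply, Pi.smul_apply, hval,
        smul_eq_mul] at h2
    rw [h2]; rfl

lemma rayleigh_bdd {d : ℕ} {Ω : Set (Euc d)} (hΩ : IsConvexDomain Ω) {k : ℕ}
    {V : Submodule ℝ (Euc d → ℝ)} (hV : ∀ u ∈ V, ContDiff ℝ (⊤ : ℕ∞) u)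
    (hfin : Module.finrank ℝ (V.map (LinearMap.funLeft ℝ ℝ ((↑) : Ω → Euc d))) = k + 1) :
    BddAbove { r : ℝ | ∃ u ∈ V, (0 < ∫ x in Ω, (u x) ^ 2) ∧ r = rayleigh Ω u } := by
  obtain ⟨hne, ho, hb, -⟩ := hΩ
  obtain ⟨v, hvV, hinj, hspan⟩ := exists_coeffs hfin
  have hvc : ∀ i, Continuous (v i) := fun i => (hV _ (hvV i)).continuous
  -- bound on gradients
  have hC : ∀ i, ∃ C, ∀ x ∈ Ω, ‖fderiv ℝ (v i) x‖ ≤ C := by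
    intro i
    have hc : Continuous (fderiv ℝ (v i)) := (hV _ (hvV i)).continuous_fderiv (by simp)
    obtain ⟨C, hC⟩ := hb.isCompact_closure.exists_bound_of_continuousOn hc.continuousOn
    exact ⟨C, fun x hx => hC x (subset_closure hx)⟩
  choose C hC using hC
  have hC0 : ∀ i, 0 ≤ C i := fun i => by
    obtain ⟨x, hx⟩ := hne
    exact (norm_nonneg _).trans (hC i x hx)
  -- lower bound on the L2 norm
  have hBcont : Continuous (fun a : Fin (k+1) → ℝ => ∫ x in Ω, (∑ i, a i * v i x) ^ 2) := by
    have : (fun a : Fin (k+1) → ℝ => ∫ x in Ω, (∑ i, a i * v i x) ^ 2) =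
        fun a => ∑ i, ∑ j, a i * a j * ∫ x in Ω, v i x * v j x := by
      funext a
      have : ∀ x, (∑ i, a i * v i x) ^ 2 = ∑ i, ∑ j, a i * a j * (v i x * v j x) := by
        intro x
        rw [sq, Finset.sum_mul_sum]
        refine Finset.sum_congr rfl fun i _ => Finset.sum_congr rfl fun j _ => by ring
      simp_rw [this]
      rw [integral_finsetSum]
      · refine Finset.sum_congr rfl fun i _ => ?_
        rw [integral_finsetSum]
        · refine Finset.sum_congr rfl fun j _ => ?_
          rw [integral_const_mul]
        · intro j _
          exact integrableOn_of_cont hb (by have := hvc i; have := hvc j; fun_prop)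
      · intro i _
        exact integrableOn_of_cont hb (by fun_prop)
    rw [this]
    fun_prop
  obtain ⟨a0, ha0, hmin⟩ := (isCompact_sphere (0 : Fin (k+1) → ℝ) 1).exists_isMinOn
    (by exact NormedSpace.sphere_nonempty.2 zero_le_one) hBcont.continuousOn
  set m := ∫ x in Ω, (∑ i, a0 i * v i x) ^ 2 with hm
  have hmpos : 0 < m := by
    have : ∃ x ∈ Ω, ∑ i, a0 i * v i x ≠ 0 := by
      by_contra! hcon
      have := hinj a0 hcon
      rw [this] at ha0
      simp at ha0
    obtain ⟨x, hx, hxne⟩ := this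
    exact setIntegral_sq_pos (u := fun x => ∑ i, a0 i * v i x) ho hb (by fun_prop) hx hxne
  refine ⟨(volume Ω).toReal * (∑ i, C i) ^ 2 / m, ?_⟩
  rintro r ⟨u, hu, hpos, rfl⟩
  obtain ⟨a, ha⟩ := hspan u hu
  have haeq : ∫ x in Ω, (u x)^2 = ∫ x in Ω, (∑ i, a i * v i x) ^ 2 :=
    setIntegral_congr_fun ho.measurableSet fun x hx => by simp only [ha x hx]
  have hane : a ≠ 0 := by
    rintro rfl
    rw [haeq] at hpos
    simp at hpos
  have hnpos : 0 < ‖a‖ := norm_pos_iff.2 hane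
  have hB : ‖a‖ ^ 2 * m ≤ ∫ x in Ω, (u x)^2 := by
    have h1 : m ≤ ∫ x in Ω, (∑ i, (‖a‖⁻¹ • a) i * v i x) ^ 2 := by
      apply hmin
      simp [norm_smul, hnpos.ne']
    have h2 : ∫ x in Ω, (∑ i, (‖a‖⁻¹ • a) i * v i x) ^ 2 =
        (‖a‖⁻¹)^2 * ∫ x in Ω, (∑ i, a i * v i x) ^ 2 := by
      rw [← integral_const_mul]
      congr 1; funext x
      rw [← mul_pow, Finset.mul_sum]
      simp [mul_assoc]
    rw [h2] at h1
    rw [haeq]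
    have := mul_le_mul_of_nonneg_left h1 (sq_nonneg ‖a‖)
    rwa [← mul_assoc, ← mul_pow, mul_inv_cancel₀ hnpos.ne', one_pow, one_mul] at this
  have hA : ∫ x in Ω, ‖fderiv ℝ u x‖ ^ 2 ≤ (volume Ω).toReal * (‖a‖ * ∑ i, C i) ^ 2 := by
    have hle : ∀ x ∈ Ω, ‖fderiv ℝ u x‖ ^ 2 ≤ (‖a‖ * ∑ i, C i) ^ 2 := by
      intro x hx
      have h1 : fderiv ℝ u x = ∑ i, a i • fderiv ℝ (v i) x := by
        rw [fderiv_eq_of_eqOn ho (v := fun x => ∑ i, a i * v i x) (fun y hy => ha y hy) hx]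
        rw [fderiv_fun_sum]
        · refine Finset.sum_congr rfl fun i _ => ?_
          rw [fderiv_const_mul]
          exact (hV _ (hvV i)).differentiable (by simp) x
        · intro i _
          exact ((hV _ (hvV i)).differentiable (by simp) x).const_mul _
      rw [h1]
      gcongr
      refine (norm_sum_le _ _).trans ?_
      rw [Finset.mul_sum]
      refine Finset.sum_le_sum fun i _ => ?_
      rw [norm_smul]
      exact mul_le_mul (norm_le_pi_norm a i) (hC i x hx) (norm_nonneg _) (norm_nonneg _)
    calc ∫ x in Ω, ‖fderiv ℝ u x‖ ^ 2 ≤ ∫ x in Ω, (‖a‖ * ∑ i, C i) ^ 2 := by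
          refine setIntegral_mono_on ?_ ?_ ho.measurableSet hle
          · have hc : Continuous (fderiv ℝ u) := (hV _ hu).continuous_fderiv (by simp)
            exact integrableOn_of_cont hb (by fun_prop)
          · exact integrableOn_of_cont hb (by fun_prop)
      _ = _ := by rw [setIntegral_const]; simp [Measure.real]
  unfold rayleigh
  rw [div_le_div_iff₀ hpos hmpos]
  calc _ ≤ (volume Ω).toReal * (‖a‖ * ∑ i, C i) ^ 2 * m := by gcongr
    _ = (volume Ω).toReal * (∑ i, C i) ^ 2 * (‖a‖^2 * m) := by ring
    _ ≤ _ := by gcongr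

lemma eig_set_nonempty {d : ℕ} (hd : 0 < d) {Ω : Set (Euc d)} (hΩ : IsConvexDomain Ω) (k : ℕ) :
    ∃ V : Submodule ℝ (Euc d → ℝ), (∀ u ∈ V, ContDiff ℝ (⊤ : ℕ∞) u) ∧
    Module.finrank ℝ (V.map (LinearMap.funLeft ℝ ℝ ((↑) : Ω → Euc d))) = k + 1 := by
  obtain ⟨⟨x0, hx0⟩, ho, hb, -⟩ := hΩ
  let i0 : Fin d := ⟨0, hd⟩
  let p : Fin (k+1) → Euc d → ℝ := fun j x => x i0 ^ (j : ℕ)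
  refine ⟨Submodule.span ℝ (Set.range p), ?_, ?_⟩
  · intro u hu
    induction hu using Submodule.span_induction with
    | mem x h =>
      obtain ⟨j, rfl⟩ := h
      simp only [p]
      fun_prop
    | zero => exact contDiff_const
    | add x y _ _ hx hy => exact hx.add hy
    | smul a x _ hx => exact contDiff_const.smul hx
  · rw [Submodule.map_span, ← Set.range_comp, finrank_span_eq_card]
    · simp
    · rw [Fintype.linearIndependent_iff]
      intro a ha
      -- the polynomial vanishes at infinitely many points
      let P : Polynomial ℝ := ∑ j : Fin (k+1), Polynomial.C (a j) * Polynomial.X ^ (j : ℕ)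
      have hev : ∀ x ∈ Ω, P.eval (x i0) = 0 := by
        intro x hx
        have := congrFun ha ⟨x, hx⟩
        simpa [P, Polynomial.eval_finsetSum, p, LinearMap.funLeft_apply] using this
      have hP : P = 0 := by
        have hopen : IsOpen ((fun x : Euc d => x i0) '' Ω) := by
          have : IsOpenMap (fun x : Euc d => x i0) := by
            have h := (EuclideanSpace.proj (𝕜 := ℝ) i0 : Euc d →L[ℝ] ℝ).isOpenMap (by
              intro y
              exact ⟨EuclideanSpace.single i0 y, by simp⟩)
            exact h
          exact this _ ho
        refine Polynomial.eq_zero_of_infinite_isRoot P (Set.Infinite.mono ?_ (infinite_of_mem_nhds (x0 i0) (hopen.mem_nhds ⟨x0, hx0, rfl⟩)))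
        rintro _ ⟨x, hx, rfl⟩
        exact hev x hx
      intro i
      have := congrArg (fun Q => Polynomial.coeff Q (i:ℕ)) hP
      simpa [P, Polynomial.finsetSum_coeff, Polynomial.coeff_X_pow, Fin.val_inj] using this

theorem neumann_nonneg {d : ℕ} (k : ℕ) (Ω : Set (Euc d)) : 0 ≤ neumannEigenvalue k Ω := by
  apply Real.sInf_nonneg
  rintro t ⟨V, -, -, rfl⟩
  apply Real.sSup_nonneg
  rintro r ⟨u, -, -, rfl⟩
  exact div_nonneg (integral_nonneg fun x => by positivity) (integral_nonneg fun x => by positivity)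

theorem minmax_lower {d : ℕ} (hd : 0 < d) {Ω : Set (Euc d)} (hΩ : IsConvexDomain Ω) (k : ℕ)
    (lam : ℝ) {ι : Type} [Fintype ι] (hcard : Fintype.card ι ≤ k) (A : ι → Set (Euc d))
    (hA : ∀ j, Bornology.IsBounded (A j)) (g : ι → Euc d → ℝ) (hg : ∀ j, Continuous (g j))
    (H : ∀ u : Euc d → ℝ, ContDiff ℝ (⊤ : ℕ∞) u → (∀ j, ∫ x in A j, u x * g j x = 0) →
      lam * ∫ x in Ω, (u x)^2 ≤ ∫ x in Ω, ‖fderiv ℝ u x‖ ^ 2) :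
    lam ≤ neumannEigenvalue k Ω := by
  apply le_csInf
  · obtain ⟨V, h1, h2⟩ := eig_set_nonempty hd hΩ k
    exact ⟨_, V, h1, h2, rfl⟩
  rintro t ⟨V, hV, hfin, rfl⟩
  have hbdd := rayleigh_bdd hΩ hV hfin
  obtain ⟨v, hvV, hinj, -⟩ := exists_coeffs hfin
  have hvc : ∀ i, Continuous (v i) := fun i => (hV _ (hvV i)).continuous
  let M : Matrix ι (Fin (k+1)) ℝ := fun j i => ∫ x in A j, v i x * g j x
  have hker : LinearMap.ker M.mulVecLin ≠ ⊥ := by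
    apply LinearMap.ker_ne_bot_of_finrank_lt
    simp; omega
  obtain ⟨a, ha, hane⟩ := Submodule.exists_mem_ne_zero_of_ne_bot hker
  have hex : ∃ x ∈ Ω, ∑ i, a i * v i x ≠ 0 := by
    by_contra! hcon
    exact hane (hinj a hcon)
  obtain ⟨x, hx, hxne⟩ := hex
  let u : Euc d → ℝ := ∑ i, a i • v i
  have hux : ∀ x, u x = ∑ i, a i * v i x := by intro x; simp [u]
  have huV : u ∈ V := Submodule.sum_mem _ fun i _ => V.smul_mem _ (hvV i)
  have hpos : 0 < ∫ x in Ω, (u x)^2 :=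
    setIntegral_sq_pos hΩ.2.1 hΩ.2.2.1 (hV u huV).continuous hx (by rwa [hux])
  have hH := H u (hV u huV) (by
    intro j
    have h0 := congrFun (LinearMap.mem_ker.1 ha) j
    simp only [Matrix.mulVecLin_apply, Matrix.mulVec, dotProduct, M, Pi.zero_apply] at h0
    rw [← h0]
    have : ∀ x, u x * g j x = ∑ i, (v i x * g j x) * a i := by
      intro x
      rw [hux, Finset.sum_mul]
      exact Finset.sum_congr rfl fun i _ => by ring
    simp_rw [this]
    rw [integral_finsetSum]
    · refine Finset.sum_congr rfl fun i _ => ?_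
      rw [integral_mul_const]
    · intro i _
      refine integrableOn_of_cont (hA j) ?_
      have := hvc i; have := hg j; fun_prop)
  refine le_trans ?_ (le_csSup hbdd ⟨u, huV, hpos, rfl⟩)
  unfold rayleigh
  rwa [le_div_iff₀ hpos]


lemma abstract_spectral {E : Type} [AddCommGroup E] [Module ℝ E] (B D : LinearMap.BilinForm ℝ E)
    (hBs : ∀ x y, B x y = B y x) (hDs : ∀ x y, D x y = D y x)
    (hB0 : ∀ x, 0 ≤ B x x) (hD0 : ∀ x, 0 ≤ D x x) {ι : Type} (c : ι → E) (μ : ι → ℝ)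
    (hG : ∀ u n, D u (c n) = μ n * B u (c n))
    (horth : ∀ n m, n ≠ m → B (c n) (c m) = 0) (hpos : ∀ n, 0 < B (c n) (c n))
    (lam : ℝ) (hlam : 0 < lam) (u : E) (hu : ∀ n, μ n < lam → B u (c n) = 0)
    (happ : ∀ ε : ℝ, 0 < ε → ∃ w ∈ Submodule.span ℝ (Set.range c), B (u - w) (u - w) ≤ ε) :
    lam * B u u ≤ D u u := by
  refine le_of_forall_pos_le_add fun ε hε => ?_
  obtain ⟨w, hw, hwε⟩ := happ (ε / lam) (by positivity)
  obtain ⟨b, rfl⟩ := (Finsupp.mem_span_range_iff_exists_finsupp).1 hw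
  set S := b.support
  let a : ι → ℝ := fun n => B u (c n) / B (c n) (c n)
  set p : E := ∑ n ∈ S, a n • c n with hp
  set w : E := b.sum fun n r => r • c n with hwdef
  have hpc : ∀ n ∈ S, B p (c n) = a n * B (c n) (c n) := by
    intro n hn
    rw [hp, map_sum, LinearMap.sum_apply, Finset.sum_eq_single n]
    · simp
    · intro m _ hmn
      simp [horth m n hmn]
    · exact fun h => absurd hn h
  have hac : ∀ n, a n * B (c n) (c n) = B u (c n) := fun n => by
    simp only [a]; field_simp [(hpos n).ne']
  have hq : ∀ n ∈ S, B (u - p) (c n) = 0 := by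
    intro n hn
    rw [map_sub, LinearMap.sub_apply, hpc n hn, hac, sub_self]
  have hqp : B (u - p) p = 0 := by
    rw [hp, map_sum]
    refine Finset.sum_eq_zero fun n hn => ?_
    rw [map_smul, ← hp, hq n hn, smul_zero]
  have hqw : B (u - p) w = 0 := by
    rw [hwdef, Finsupp.sum, map_sum]
    refine Finset.sum_eq_zero fun n hn => ?_
    rw [map_smul, hq n hn, smul_zero]
  have hDqp : D (u - p) p = 0 := by
    rw [hp, map_sum]
    refine Finset.sum_eq_zero fun n hn => ?_
    rw [map_smul, ← hp, hG, hq n hn, mul_zero, smul_zero]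
  have h1 : B (u - p) (u - p) ≤ ε / lam := by
    refine le_trans ?_ hwε
    have e : u - w = (u - p) + (p - w) := by abel
    have h0 : B (u - p) (p - w) = 0 := by rw [map_sub, hqp, hqw, sub_self]
    rw [e, map_add, map_add, LinearMap.add_apply, LinearMap.add_apply, hBs (p - w) (u - p), h0]
    have := hB0 (p - w)
    linarith
  have h2 : B u u = B p p + B (u - p) (u - p) := by
    have e : u = (u - p) + p := by abel
    conv_lhs => rw [e]
    rw [map_add, map_add, LinearMap.add_apply, LinearMap.add_apply, hBs p (u - p), hqp]
    ring
  have h3 : D u u = D p p + D (u - p) (u - p) := by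
    have e : u = (u - p) + p := by abel
    conv_lhs => rw [e]
    rw [map_add, map_add, LinearMap.add_apply, LinearMap.add_apply, hDs p (u - p), hDqp]
    ring
  have h4 : lam * B p p ≤ D p p := by
    have e1 : B p p = ∑ n ∈ S, a n * B p (c n) := by
      conv_lhs => rw [hp, map_sum, ← hp]
      exact Finset.sum_congr rfl fun n _ => by rw [map_smul, smul_eq_mul]
    have e2 : D p p = ∑ n ∈ S, a n * (μ n * B p (c n)) := by
      conv_lhs => rw [hp, map_sum, ← hp]
      exact Finset.sum_congr rfl fun n _ => by rw [map_smul, smul_eq_mul, hG]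
    rw [e1, e2, Finset.mul_sum]
    refine Finset.sum_le_sum fun n hn => ?_
    rw [hpc n hn]
    rcases lt_or_ge (μ n) lam with h | h
    · have : a n = 0 := by simp [a, hu n h]
      simp [this]
    · have := hpos n
      have h5 : 0 ≤ a n * a n * B (c n) (c n) := mul_nonneg (mul_self_nonneg _) this.le
      nlinarith
  have h5 := hD0 (u - p)
  have h6 : lam * B (u - p) (u - p) ≤ ε := by
    have := mul_le_mul_of_nonneg_left h1 hlam.le
    rwa [mul_div_cancel₀ _ hlam.ne'] at this
  rw [h2, h3]
  linarith

section cube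

/-- The `i`-th basis vector. -/
abbrev eb {N : ℕ} (i : Fin N) : Fin N → ℝ := Pi.single i 1

def cosP {N : ℕ} (a : Fin N → ℝ) (l : ℝ) (r : Fin N → ℝ) (x : Fin N → ℝ) : ℝ :=
  ∏ j, cos (r j * π / l * (x j - a j))

def sinP {N : ℕ} (a : Fin N → ℝ) (l : ℝ) (r : Fin N → ℝ) (i : Fin N) (x : Fin N → ℝ) : ℝ :=
  sin (r i * π / l * (x i - a i)) * ∏ j ∈ Finset.univ.erase i, cos (r j * π / l * (x j - a j))

lemma cosP_smooth {N : ℕ} (a : Fin N → ℝ) (l : ℝ) (r : Fin N → ℝ) :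
    ContDiff ℝ (⊤ : ℕ∞) (cosP a l r) := by
  unfold cosP
  refine contDiff_prod fun j _ => ?_
  fun_prop

lemma sinP_smooth {N : ℕ} (a : Fin N → ℝ) (l : ℝ) (r : Fin N → ℝ) (i : Fin N) :
    ContDiff ℝ (⊤ : ℕ∞) (sinP a l r i) := by
  unfold sinP
  refine ContDiff.mul (by fun_prop) (contDiff_prod fun j _ => ?_)
  fun_prop

lemma fderiv_eb_eq {N : ℕ} {f : (Fin N → ℝ) → ℝ} (hf : ContDiff ℝ (⊤ : ℕ∞) f) (i : Fin N)
    (x : Fin N → ℝ) {f' : ℝ} (h : HasDerivAt (fun t : ℝ => f (x + t • eb i)) f' 0) :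
    fderiv ℝ f x (eb i) = f' := by
  rw [← DifferentiableAt.lineDeriv_eq_fderiv (hf.differentiable (by simp) x)]
  exact HasLineDerivAt.lineDeriv h

lemma rest_const {N : ℕ} (a : Fin N → ℝ) (l : ℝ) (r : Fin N → ℝ) (i : Fin N) (x : Fin N → ℝ)
    (t : ℝ) : ∏ j ∈ Finset.univ.erase i, cos (r j * π / l * ((x + t • eb i) j - a j)) =
      ∏ j ∈ Finset.univ.erase i, cos (r j * π / l * (x j - a j)) := by
  refine Finset.prod_congr rfl fun j hj => ?_
  have : j ≠ i := Finset.ne_of_mem_erase hj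
  simp [this]

lemma cosP_eq {N : ℕ} (a : Fin N → ℝ) (l : ℝ) (r : Fin N → ℝ) (i : Fin N) (x : Fin N → ℝ) :
    cosP a l r x = cos (r i * π / l * (x i - a i)) *
      ∏ j ∈ Finset.univ.erase i, cos (r j * π / l * (x j - a j)) := by
  unfold cosP
  exact (Finset.mul_prod_erase Finset.univ (fun j => cos (r j * π / l * (x j - a j)))
    (Finset.mem_univ i)).symm

lemma fderiv_cosP {N : ℕ} (a : Fin N → ℝ) (l : ℝ) (r : Fin N → ℝ) (i : Fin N) (x : Fin N → ℝ) :
    fderiv ℝ (cosP a l r) x (eb i) = -(r i * π / l) * sinP a l r i x := by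
  apply fderiv_eb_eq (cosP_smooth a l r)
  simp only [cosP_eq a l r i, rest_const, sinP]
  have h1 : HasDerivAt (fun t : ℝ => r i * π / l * ((x + t • eb i) i - a i)) (r i * π / l) 0 := by
    simp only [Pi.add_apply, Pi.smul_apply, Pi.single_eq_same, smul_eq_mul, mul_one]
    simpa using (((hasDerivAt_id (0:ℝ)).const_add (x i)).sub_const (a i)).const_mul (r i * π / l)
  have h2 := (h1.cos).mul_const (∏ j ∈ Finset.univ.erase i, cos (r j * π / l * (x j - a j)))
  refine h2.congr_deriv ?_
  simp
  ring

lemma fderiv_sinP {N : ℕ} (a : Fin N → ℝ) (l : ℝ) (r : Fin N → ℝ) (i : Fin N) (x : Fin N → ℝ) :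
    fderiv ℝ (sinP a l r i) x (eb i) = (r i * π / l) * cosP a l r x := by
  apply fderiv_eb_eq (sinP_smooth a l r i)
  simp only [cosP_eq a l r i, rest_const, sinP]
  have h1 : HasDerivAt (fun t : ℝ => r i * π / l * ((x + t • eb i) i - a i)) (r i * π / l) 0 := by
    simp only [Pi.add_apply, Pi.smul_apply, Pi.single_eq_same, smul_eq_mul, mul_one]
    simpa using (((hasDerivAt_id (0:ℝ)).const_add (x i)).sub_const (a i)).const_mul (r i * π / l)
  have h2 := (h1.sin).mul_const (∏ j ∈ Finset.univ.erase i, cos (r j * π / l * (x j - a j)))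
  refine h2.congr_deriv ?_
  simp
  ring

/-- Integration of a partial derivative of a function vanishing on two opposite faces. -/
lemma integral_partial_zero {m : ℕ} (a b : Fin (m+1) → ℝ) (hab : a ≤ b) (i : Fin (m+1))
    {F : (Fin (m+1) → ℝ) → ℝ} (hF : ContDiff ℝ (⊤ : ℕ∞) F)
    (h1 : ∀ x, x i = a i → F x = 0) (h2 : ∀ x, x i = b i → F x = 0) :
    ∫ x in Set.Icc a b, fderiv ℝ F x (eb i) = 0 := by
  have hc : Continuous (fderiv ℝ F) := hF.continuous_fderiv (by simp)
  have key := integral_divergence_of_hasFDerivAt_off_countable' a b hab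
    (fun j => if j = i then F else fun _ => 0)
    (fun j x => if j = i then fderiv ℝ F x else 0) ∅ Set.countable_empty
    (by
      intro j
      by_cases hj : j = i
      · simp only [hj, if_true]; exact hF.continuous.continuousOn
      · simp only [hj, if_false]; exact continuousOn_const)
    (by
      intro x _ j
      by_cases hj : j = i
      · simp only [hj, if_true]; exact (hF.differentiable (by simp) x).hasFDerivAt
      · simp only [hj, if_false]; exact hasFDerivAt_const _ _)
    (by
      apply Continuous.integrableOn_Icc
      refine continuous_finsetSum _ fun j _ => ?_
      by_cases hj : j = i
      · simp only [hj, if_true]; fun_prop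
      · simp only [hj, if_false]; simpa using continuous_const)
  have e1 : ∀ x, ∑ j, (if j = i then fderiv ℝ F x else 0) (Pi.single j 1) =
      fderiv ℝ F x (eb i) := by
    intro x
    rw [Finset.sum_eq_single i]
    · simp
    · intro j _ hj; simp [hj]
    · simp
  simp only [e1] at key
  rw [key]
  refine Finset.sum_eq_zero fun j _ => ?_
  by_cases hj : j = i
  · subst hj
    simp [h1, h2]
  · simp [hj]

lemma green_i {m : ℕ} (a : Fin (m+1) → ℝ) {l : ℝ} (hl : 0 < l) (n : Fin (m+1) → ℕ)
    (i : Fin (m+1)) {u : (Fin (m+1) → ℝ) → ℝ} (hu : ContDiff ℝ (⊤ : ℕ∞) u) :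
    ∫ x in Set.Icc a (fun j => a j + l),
      fderiv ℝ u x (eb i) * fderiv ℝ (cosP a l (fun j => (n j : ℝ))) x (eb i) =
    (n i * π / l) ^ 2 * ∫ x in Set.Icc a (fun j => a j + l), u x * cosP a l (fun j => (n j : ℝ)) x := by
  have hs := sinP_smooth a l (fun j => (n j : ℝ)) i
  have hcs := cosP_smooth a l (fun j => (n j : ℝ))
  have h0 := integral_partial_zero a (fun j => a j + l) (fun j => by simp [hl.le]) i
    (hu.mul hs)
    (by intro x hx; simp [sinP, hx])
    (by
      intro x hx
      have : (n i : ℝ) * π / l * (x i - a i) = n i * π := by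
        rw [hx]; field_simp; ring
      simp [sinP, this, sin_nat_mul_pi])
  have e : ∀ x, fderiv ℝ (u * sinP a l (fun j => (n j : ℝ)) i) x (eb i) =
      fderiv ℝ u x (eb i) * sinP a l (fun j => (n j : ℝ)) i x +
      (n i * π / l) * (u x * cosP a l (fun j => (n j : ℝ)) x) := by
    intro x
    rw [fderiv_mul (hu.differentiable (by simp) x) (hs.differentiable (by simp) x)]
    simp only [add_apply, smul_apply, fderiv_sinP,
      smul_eq_mul]
    ring
  have hcu : Continuous (fderiv ℝ u) := hu.continuous_fderiv (by simp)
  have := hs.continuous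
  have := hcs.continuous
  have := hu.continuous
  change ∫ x in Set.Icc a (fun j => a j + l),
    fderiv ℝ (u * sinP a l (fun j => (n j : ℝ)) i) x (eb i) = 0 at h0
  simp only [e] at h0
  rw [integral_add, integral_const_mul] at h0
  · simp only [fderiv_cosP]
    have e2 : ∀ x, fderiv ℝ u x (eb i) * (-(↑(n i) * π / l) * sinP a l (fun j => (n j : ℝ)) i x) =
      (-(↑(n i) * π / l)) * (fderiv ℝ u x (eb i) * sinP a l (fun j => (n j : ℝ)) i x) := by
      intro x; ring
    simp only [e2]
    rw [integral_const_mul]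
    linear_combination (-(n i * π / l)) * h0
  · apply Continuous.integrableOn_Icc; fun_prop
  · apply Continuous.integrableOn_Icc; fun_prop

end cube


lemma orth_cosP {m : ℕ} (a : Fin (m+1) → ℝ) {l : ℝ} (hl : 0 < l) (n k : Fin (m+1) → ℕ)
    (hnk : n ≠ k) :
    ∫ x in Set.Icc a (fun j => a j + l),
      cosP a l (fun j => (n j : ℝ)) x * cosP a l (fun j => (k j : ℝ)) x = 0 := by
  obtain ⟨i, hi⟩ := Function.ne_iff.1 hnk
  have h1 := green_i a hl k i (cosP_smooth a l (fun j => (n j : ℝ)))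
  have h2 := green_i a hl n i (cosP_smooth a l (fun j => (k j : ℝ)))
  simp only [mul_comm (fderiv ℝ (cosP a l (fun j => (k j : ℝ))) _ _) _,
    mul_comm (cosP a l (fun j => (k j : ℝ)) _) _] at h2
  rw [h1] at h2
  have h3 : (((k i : ℝ) * π / l) ^ 2 - ((n i : ℝ) * π / l) ^ 2) ≠ 0 := by
    intro h
    rw [sub_eq_zero] at h
    have h4 := (pow_left_inj₀ (by positivity) (by positivity) two_ne_zero).1 h
    have h5 : (k i : ℝ) = n i := by
      have := pi_pos
      field_simp at h4
      exact h4
    exact hi (by exact_mod_cast h5.symm)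
  have h4 : (((k i : ℝ) * π / l) ^ 2 - ((n i : ℝ) * π / l) ^ 2) *
    ∫ x in Set.Icc a (fun j => a j + l),
      cosP a l (fun j => (n j : ℝ)) x * cosP a l (fun j => (k j : ℝ)) x = 0 := by
    rw [sub_mul, h2, sub_self]
  exact (mul_eq_zero.1 h4).resolve_left h3

lemma pos_cosP {m : ℕ} (a : Fin (m+1) → ℝ) {l : ℝ} (hl : 0 < l) (r : Fin (m+1) → ℝ) :
    0 < ∫ x in Set.Icc a (fun j => a j + l), cosP a l r x * cosP a l r x := by
  have hc := (cosP_smooth a l r).continuous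
  rw [setIntegral_pos_iff_support_of_nonneg_ae]
  · have ho : IsOpen (Function.support (fun x => cosP a l r x * cosP a l r x)) :=
      (hc.mul hc).isOpen_support
    have ha : a ∈ Function.support (fun x => cosP a l r x * cosP a l r x) := by
      simp [cosP]
    -- interior of the cube
    have hcl : a ∈ closure (Set.pi Set.univ fun j => Set.Ioo (a j) (a j + l)) := by
      rw [closure_pi_set]
      intro j _
      simp only
      rw [closure_Ioo (by linarith)]
      exact ⟨le_rfl, by linarith⟩
    obtain ⟨y, hy1, hy2⟩ := mem_closure_iff.1 hcl _ ho ha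
    have hopen : IsOpen (Set.pi Set.univ fun j => Set.Ioo (a j) (a j + l)) :=
      isOpen_set_pi Set.finite_univ fun j _ => isOpen_Ioo
    refine lt_of_lt_of_le ((ho.inter hopen).measure_pos volume ⟨y, hy1, hy2⟩) (measure_mono ?_)
    rintro x ⟨hx1, hx2⟩
    exact ⟨hx1, fun j => (hx2 j trivial).1.le, fun j => (hx2 j trivial).2.le⟩
  · exact Filter.Eventually.of_forall fun x => mul_self_nonneg _
  · exact (hc.mul hc).integrableOn_Icc

/-- smooth functions -/
def smoothS (N : ℕ) : Submodule ℝ ((Fin N → ℝ) → ℝ) where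
  carrier := {u | ContDiff ℝ (⊤ : ℕ∞) u}
  add_mem' := by
    intro u v h1 h2
    simp only [Set.mem_ofPred_eq] at h1 h2 ⊢
    exact h1.add h2
  zero_mem' := by
    simp only [Set.mem_ofPred_eq]
    exact contDiff_const
  smul_mem' := by
    intro c u h
    simp only [Set.mem_ofPred_eq] at h ⊢
    exact contDiff_const.smul h

lemma smoothS_cd {N : ℕ} (u : smoothS N) : ContDiff ℝ (⊤ : ℕ∞) u.1 := by
  have h := u.2
  simp only [smoothS, Submodule.mem_mk, AddSubmonoid.mem_mk, AddSubsemigroup.mem_mk,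
    Set.mem_ofPred_eq] at h
  exact h

lemma mem_smoothS {N : ℕ} {u : (Fin N → ℝ) → ℝ} (h : ContDiff ℝ (⊤ : ℕ∞) u) : u ∈ smoothS N := by
  simp only [smoothS, Submodule.mem_mk, AddSubmonoid.mem_mk, AddSubsemigroup.mem_mk,
    Set.mem_ofPred_eq]
  exact h

def formB {N : ℕ} (a b : Fin N → ℝ) : LinearMap.BilinForm ℝ (smoothS N) :=
  LinearMap.mk₂ ℝ (fun u v => ∫ x in Set.Icc a b, u.1 x * v.1 x)
    (by
      intro u v w
      have := (smoothS_cd u).continuous; have := (smoothS_cd v).continuous; have := (smoothS_cd w).continuous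
      rw [← integral_add (Continuous.integrableOn_Icc (by fun_prop))
        (Continuous.integrableOn_Icc (by fun_prop))]
      congr 1; funext x
      simp [add_mul])
    (by
      intro c u v
      simp only [smul_eq_mul]
      rw [← integral_const_mul]
      congr 1; funext x; simp [mul_assoc])
    (by
      intro u v w
      have := (smoothS_cd u).continuous; have := (smoothS_cd v).continuous; have := (smoothS_cd w).continuous
      rw [← integral_add (Continuous.integrableOn_Icc (by fun_prop))
        (Continuous.integrableOn_Icc (by fun_prop))]
      congr 1; funext x
      simp [mul_add])
    (by
      intro c u v
      simp only [smul_eq_mul]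
      rw [← integral_const_mul]
      congr 1; funext x; simp; ring)

lemma smoothS_cont {N : ℕ} (u : smoothS N) : Continuous (fderiv ℝ u.1) :=
  ContDiff.continuous_fderiv (smoothS_cd u) (by simp)

lemma smoothS_fadd {N : ℕ} (u v : smoothS N) (x) :
    fderiv ℝ (u + v).1 x = fderiv ℝ u.1 x + fderiv ℝ v.1 x :=
  fderiv_add (ContDiff.differentiable (smoothS_cd u) (by simp) x) (ContDiff.differentiable (smoothS_cd v) (by simp) x)

lemma smoothS_fsmul {N : ℕ} (c : ℝ) (u : smoothS N) (x) :
    fderiv ℝ (c • u).1 x = c • fderiv ℝ u.1 x :=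
  fderiv_const_smul (ContDiff.differentiable (smoothS_cd u) (by simp) x) c

def formD {N : ℕ} (a b : Fin N → ℝ) : LinearMap.BilinForm ℝ (smoothS N) :=
  LinearMap.mk₂ ℝ (fun u v => ∫ x in Set.Icc a b,
      ∑ i, fderiv ℝ u.1 x (eb i) * fderiv ℝ v.1 x (eb i))
    (by
      intro u v w
      have := smoothS_cont u; have := smoothS_cont v; have := smoothS_cont w
      rw [← integral_add (Continuous.integrableOn_Icc (by fun_prop))
        (Continuous.integrableOn_Icc (by fun_prop))]
      congr 1; funext x
      rw [← Finset.sum_add_distrib]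
      simp only [smoothS_fadd, add_apply, add_mul])
    (by
      intro c u v
      simp only [smul_eq_mul]
      rw [← integral_const_mul]
      congr 1; funext x; 
      rw [Finset.mul_sum]
      simp only [smoothS_fsmul, smul_apply, smul_eq_mul, mul_assoc])
    (by
      intro u v w
      have := smoothS_cont u; have := smoothS_cont v; have := smoothS_cont w
      rw [← integral_add (Continuous.integrableOn_Icc (by fun_prop))
        (Continuous.integrableOn_Icc (by fun_prop))]
      congr 1; funext x
      rw [← Finset.sum_add_distrib]
      simp only [smoothS_fadd, add_apply, mul_add])
    (by
      intro c u v
      simp only [smul_eq_mul]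
      rw [← integral_const_mul]
      congr 1; funext x; 
      rw [Finset.mul_sum]
      simp only [smoothS_fsmul, smul_apply, smul_eq_mul, mul_left_comm])

def cosS {N : ℕ} (a : Fin N → ℝ) (l : ℝ) (n : Fin N → ℕ) : smoothS N :=
  ⟨cosP a l (fun j => (n j : ℝ)), mem_smoothS (cosP_smooth _ _ _)⟩

lemma cosP_natAbs {N : ℕ} (a : Fin N → ℝ) (l : ℝ) (z : Fin N → ℤ) :
    cosP a l (fun j => (z j : ℝ)) = cosP a l (fun j => ((z j).natAbs : ℝ)) := by
  funext x
  unfold cosP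
  refine Finset.prod_congr rfl fun j _ => ?_
  rcases Int.natAbs_eq (z j) with h | h
  · have : (z j : ℝ) = ((z j).natAbs : ℝ) := by
      have := congrArg (Int.cast (R := ℝ)) h
      simpa only [Int.cast_neg, Int.cast_natCast] using this
    simp only [this]
  · have : (z j : ℝ) = -((z j).natAbs : ℝ) := by
      have := congrArg (Int.cast (R := ℝ)) h
      simpa only [Int.cast_neg, Int.cast_natCast] using this
    simp only [this]
    rw [← cos_neg]; congr 1; ring

lemma cosP_mul_cos {N : ℕ} (a : Fin N → ℝ) (l : ℝ) (z : Fin N → ℝ) (i : Fin N) (x : Fin N → ℝ) :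
    cos (π / l * (x i - a i)) * cosP a l z x =
      (1/2) * cosP a l (z + Pi.single i 1) x + (1/2) * cosP a l (z - Pi.single i 1) x := by
  have hr : ∀ s : ℝ, ∏ j ∈ Finset.univ.erase i,
      cos ((z + Pi.single i s : Fin N → ℝ) j * π / l * (x j - a j)) =
      ∏ j ∈ Finset.univ.erase i, cos (z j * π / l * (x j - a j)) := by
    intro s
    refine Finset.prod_congr rfl fun j hj => ?_
    have : j ≠ i := Finset.ne_of_mem_erase hj
    simp [this]
  have hs : z - Pi.single i (1:ℝ) = z + Pi.single i (-1) := by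
    rw [sub_eq_add_neg, Pi.single_neg]
  rw [hs, cosP_eq a l z i, cosP_eq a l _ i, cosP_eq a l (z + Pi.single i (-1)) i, hr, hr]
  simp only [Pi.add_apply, Pi.single_eq_same]
  have e1 : (z i + 1) * π / l * (x i - a i) = z i * π / l * (x i - a i) + π / l * (x i - a i) := by
    ring
  have e2 : (z i + -1) * π / l * (x i - a i) = z i * π / l * (x i - a i) - π / l * (x i - a i) := by
    ring
  rw [e1, e2, cos_add, cos_sub]
  ring

lemma cos_dense {N : ℕ} (a : Fin N → ℝ) {l : ℝ} (hl : 0 < l) (u : smoothS N) {ε : ℝ}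
    (hε : 0 < ε) : ∃ w ∈ Submodule.span ℝ (Set.range (cosS a l)),
      ∀ x ∈ Set.Icc a (fun j => a j + l), |u.1 x - w.1 x| < ε := by
  let X := Set.Icc a (fun j => a j + l)
  -- restriction map
  let R : smoothS N →ₗ[ℝ] C(X, ℝ) :=
    { toFun := fun u => ⟨fun x => u.1 x, (smoothS_cd u).continuous.comp continuous_subtype_val⟩
      map_add' := fun u v => rfl
      map_smul' := fun c u => rfl }
  let gen : Fin N → C(X, ℝ) := fun i => ⟨fun x => cos (π / l * (x.1 i - a i)), by
    have : Continuous (fun x : X => x.1 i) := (continuous_apply i).comp continuous_subtype_val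
    exact continuous_cos.comp (continuous_const.mul (this.sub continuous_const))⟩
  let W : Submodule ℝ C(X, ℝ) := (Submodule.span ℝ (Set.range (cosS a l))).map R
  have hWz : ∀ z : Fin N → ℤ, R ⟨cosP a l (fun j => (z j : ℝ)), mem_smoothS (cosP_smooth _ _ _)⟩ ∈ W := by
    intro z
    refine Submodule.mem_map_of_mem (Submodule.subset_span ⟨fun j => (z j).natAbs, ?_⟩)
    apply Subtype.ext
    exact (cosP_natAbs a l z).symm
  have hmul : ∀ i, ∀ w ∈ W, gen i * w ∈ W := by
    intro i w hw
    obtain ⟨w', hw', rfl⟩ := Submodule.mem_map.1 hw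
    clear hw
    induction hw' using Submodule.span_induction with
    | mem x h =>
      obtain ⟨n, rfl⟩ := h
      have e : gen i * R (cosS a l n) =
          (1/2 : ℝ) • R ⟨cosP a l (fun j => (((fun j => (n j : ℤ)) + Pi.single i 1 : Fin N → ℤ) j : ℝ)), mem_smoothS (cosP_smooth _ _ _)⟩
          + (1/2 : ℝ) • R ⟨cosP a l (fun j => (((fun j => (n j : ℤ)) - Pi.single i 1 : Fin N → ℤ) j : ℝ)), mem_smoothS (cosP_smooth _ _ _)⟩ := by
        ext x
        have h := cosP_mul_cos a l (fun j => (n j : ℝ)) i x.1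
        have e1 : (fun j => (((fun j => (n j : ℤ)) + Pi.single i 1 : Fin N → ℤ) j : ℝ)) =
            (fun j => (n j : ℝ)) + Pi.single i 1 := by
          funext j
          by_cases hj : j = i
          · subst hj; simp
          · simp [hj]
        have e2 : (fun j => (((fun j => (n j : ℤ)) - Pi.single i 1 : Fin N → ℤ) j : ℝ)) =
            (fun j => (n j : ℝ)) - Pi.single i 1 := by
          funext j
          by_cases hj : j = i
          · subst hj; simp
          · simp [hj]
        rw [← e1, ← e2] at h
        exact h
      rw [e]
      exact W.add_mem (W.smul_mem _ (hWz _)) (W.smul_mem _ (hWz _))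
    | zero => simp
    | add x y _ _ hx hy => rw [map_add, mul_add]; exact W.add_mem hx hy
    | smul c x _ hx => rw [map_smul, mul_smul_comm]; exact W.smul_mem _ hx
  let A := Algebra.adjoin ℝ (Set.range gen)
  have hAW : ∀ f ∈ A, ∀ w ∈ W, f * w ∈ W := by
    intro f hf
    induction hf using Algebra.adjoin_induction with
    | mem x h => obtain ⟨i, rfl⟩ := h; exact hmul i
    | algebraMap r =>
      intro w hw
      rw [← Algebra.smul_def]; exact W.smul_mem _ hw
    | add x y _ _ hx hy => intro w hw; rw [add_mul]; exact W.add_mem (hx w hw) (hy w hw)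
    | mul x y _ _ hx hy => intro w hw; rw [mul_assoc]; exact hx _ (hy w hw)
  have hone : (1 : C(X, ℝ)) ∈ W := by
    have := hWz 0
    convert this using 1
    ext x
    simp [R, cosP]
  have hsep : A.SeparatesPoints := by
    intro x y hxy
    have : ∃ i, x.1 i ≠ y.1 i := by
      by_contra! h
      exact hxy (Subtype.ext (funext h))
    obtain ⟨i, hi⟩ := this
    refine ⟨gen i, ⟨gen i, Algebra.subset_adjoin ⟨i, rfl⟩, rfl⟩, ?_⟩
    intro h
    apply hi
    have hmem : ∀ x : X, π / l * (x.1 i - a i) ∈ Set.Icc 0 π := by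
      intro x
      have h1 := x.2.1 i
      have h2 := x.2.2 i
      have h3 : 0 < π / l := by have := pi_pos; positivity
      refine ⟨mul_nonneg h3.le (by linarith), ?_⟩
      calc π / l * (x.1 i - a i) ≤ π / l * l := by
            apply mul_le_mul_of_nonneg_left _ h3.le
            simp only at h2; linarith
        _ = π := by field_simp
    have h5 := injOn_cos (hmem x) (hmem y) h
    have h3 : π / l ≠ 0 := by have := pi_pos; positivity
    have := mul_left_cancel₀ h3 h5
    linarith
  have : CompactSpace X := isCompact_iff_compactSpace.1 isCompact_Icc
  obtain ⟨⟨g, hg⟩, hgε⟩ := ContinuousMap.exists_mem_subalgebra_near_continuousMap_of_separatesPoints A hsep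
    (R u) ε hε
  have hgW : g ∈ W := by simpa using hAW g hg 1 hone
  obtain ⟨w, hw, rfl⟩ := Submodule.mem_map.1 hgW
  refine ⟨w, hw, fun x hx => ?_⟩
  rw [ContinuousMap.norm_lt_iff _ hε] at hgε
  have := hgε ⟨x, hx⟩
  rw [abs_sub_comm]
  exact this

/-- The spectral inequality on a cube. -/
theorem cube_spectral {m : ℕ} (a : Fin (m+1) → ℝ) {l : ℝ} (hl : 0 < l) {lam : ℝ} (hlam : 0 < lam)
    {u : (Fin (m+1) → ℝ) → ℝ} (hu : ContDiff ℝ (⊤ : ℕ∞) u)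
    (horth : ∀ n : Fin (m+1) → ℕ, ∑ i, (n i * π / l) ^ 2 < lam →
      ∫ x in Set.Icc a (fun j => a j + l), u x * cosP a l (fun j => (n j : ℝ)) x = 0) :
    lam * ∫ x in Set.Icc a (fun j => a j + l), (u x) ^ 2 ≤
      ∫ x in Set.Icc a (fun j => a j + l), ∑ i, (fderiv ℝ u x (eb i)) ^ 2 := by
  have key := abstract_spectral (formB a (fun j => a j + l)) (formD a (fun j => a j + l))
    (by intro u v; simp [formB, mul_comm]) (by intro u v; simp [formD, mul_comm])
    (by
      intro u; simp only [formB, LinearMap.mk₂_apply]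
      exact integral_nonneg fun x => mul_self_nonneg _)
    (by
      intro u; simp only [formD, LinearMap.mk₂_apply]
      exact integral_nonneg fun x => Finset.sum_nonneg fun i _ => mul_self_nonneg _)
    (cosS a l) (fun n => ∑ i, (n i * π / l) ^ 2)
    (by
      intro u n
      simp only [formB, formD, LinearMap.mk₂_apply]
      rw [integral_finsetSum, Finset.sum_mul]
      · refine Finset.sum_congr rfl fun i _ => ?_
        exact green_i a hl n i (smoothS_cd u)
      · intro i _
        have := smoothS_cont u; have := smoothS_cont (cosS a l n)
        exact Continuous.integrableOn_Icc (by fun_prop))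
    (by
      intro n k hnk
      simp only [formB, LinearMap.mk₂_apply]
      exact orth_cosP a hl n k hnk)
    (by
      intro n
      simp only [formB, LinearMap.mk₂_apply]
      exact pos_cosP a hl _)
    lam hlam ⟨u, mem_smoothS hu⟩
    (by
      intro n hn
      simp only [formB, LinearMap.mk₂_apply]
      exact horth n hn)
    (by
      intro ε hε
      set vol : ℝ := volume.real (Set.Icc a (fun j => a j + l))
      have hvol : 0 ≤ vol := measureReal_nonneg
      obtain ⟨w, hw, h⟩ := cos_dense a hl ⟨u, mem_smoothS hu⟩ (ε := √(ε / (vol + 1))) (by positivity)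
      refine ⟨w, hw, ?_⟩
      simp only [formB, LinearMap.mk₂_apply]
      have hcu := hu.continuous
      have hcw := (smoothS_cd w).continuous
      calc ∫ x in Set.Icc a (fun j => a j + l), ((⟨u, mem_smoothS hu⟩ : smoothS (m+1)) - w).1 x * ((⟨u, mem_smoothS hu⟩ : smoothS (m+1)) - w).1 x
          ≤ ∫ x in Set.Icc a (fun j => a j + l), ε / (vol + 1) := by
            refine setIntegral_mono_on ?_ ?_ measurableSet_Icc ?_
            · exact Continuous.integrableOn_Icc ((hcu.sub hcw).mul (hcu.sub hcw))
            · exact Continuous.integrableOn_Icc continuous_const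
            · intro x hx
              have h1 := h x hx
              have h2 : |u x - w.1 x| ^ 2 ≤ √(ε / (vol + 1)) ^ 2 := by
                have := h1.le
                gcongr
              rw [sq_abs, Real.sq_sqrt (by positivity)] at h2
              simpa [sq] using h2
        _ = vol * (ε / (vol + 1)) := by rw [setIntegral_const]; rfl
        _ ≤ ε := by
          rw [mul_div_assoc', div_le_iff₀ (by positivity)]
          nlinarith)
  simp only [formB, formD, LinearMap.mk₂_apply] at key
  simpa only [sq] using key


/-- half-open cube -/
def cubeE {d : ℕ} (a : Fin d → ℝ) (l : ℝ) : Set (Euc d) := {x | ∀ i, a i ≤ x i ∧ x i < a i + l}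

lemma cubeE_eq {d : ℕ} (a : Fin d → ℝ) (l : ℝ) : cubeE a l =
    (@WithLp.ofLp 2 (Fin d → ℝ)) ⁻¹' (Set.pi Set.univ fun i => Set.Ico (a i) (a i + l)) := by
  ext x
  simp [cubeE]

lemma measurableSet_cubeE {d : ℕ} (a : Fin d → ℝ) (l : ℝ) : MeasurableSet (cubeE a l) := by
  rw [cubeE_eq]
  exact (PiLp.volume_preserving_ofLp (Fin d)).measurable
    (MeasurableSet.univ_pi fun i => measurableSet_Ico)

lemma volume_cubeE {d : ℕ} (a : Fin d → ℝ) {l : ℝ} (hl : 0 ≤ l) :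
    volume (cubeE a l) = ENNReal.ofReal (l ^ d) := by
  rw [cubeE_eq, (PiLp.volume_preserving_ofLp (Fin d)).measure_preimage
    (MeasurableSet.univ_pi fun i => measurableSet_Ico).nullMeasurableSet, volume_pi_pi]
  simp [ENNReal.ofReal_pow hl]

lemma integral_cubeE {d : ℕ} (a : Fin d → ℝ) (l : ℝ) (f : Euc d → ℝ) :
    ∫ x in cubeE a l, f x =
      ∫ y in Set.Icc a (fun j => a j + l), f (WithLp.toLp 2 y) := by
  have h := (PiLp.volume_preserving_toLp (Fin d)).setIntegral_preimage_emb
    (MeasurableEquiv.toLp 2 (Fin d → ℝ)).measurableEmbedding f (cubeE a l)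
  rw [← h]
  have e : (@WithLp.toLp 2 (Fin d → ℝ)) ⁻¹' (cubeE a l) =
      Set.pi Set.univ fun i => Set.Ico (a i) (a i + l) := by
    ext x; simp [cubeE]
  rw [e]
  exact setIntegral_congr_set Measure.univ_pi_Ico_ae_eq_Icc

lemma norm_sq_dual {d : ℕ} (L : Euc d →L[ℝ] ℝ) :
    ‖L‖ ^ 2 = ∑ i, (L (EuclideanSpace.single i 1)) ^ 2 := by
  set g := (InnerProductSpace.toDual ℝ (Euc d)).symm L with hg
  have h1 : ‖L‖ = ‖g‖ := by rw [hg, LinearIsometryEquiv.norm_map]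
  rw [h1, ← (EuclideanSpace.basisFun (Fin d) ℝ).sum_sq_norm_inner_left g]
  refine Finset.sum_congr rfl fun i _ => ?_
  rw [EuclideanSpace.basisFun_apply, hg, InnerProductSpace.toDual_symm_apply, Real.norm_eq_abs,
    sq_abs]

theorem cube_spectral_E {m : ℕ} (a : Fin (m+1) → ℝ) {l : ℝ} (hl : 0 < l) {lam : ℝ} (hlam : 0 < lam)
    {u : Euc (m+1) → ℝ} (hu : ContDiff ℝ (⊤ : ℕ∞) u)
    (horth : ∀ n : Fin (m+1) → ℕ, ∑ i, (n i * π / l) ^ 2 < lam →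
      ∫ x in cubeE a l, u x * cosP a l (fun j => (n j : ℝ)) (WithLp.ofLp x) = 0) :
    lam * ∫ x in cubeE a l, (u x) ^ 2 ≤ ∫ x in cubeE a l, ‖fderiv ℝ u x‖ ^ 2 := by
  let e : (Fin (m+1) → ℝ) ≃L[ℝ] Euc (m+1) := (PiLp.continuousLinearEquiv 2 ℝ (fun _ : Fin (m+1) => ℝ)).symm
  have he : ∀ y, e y = WithLp.toLp 2 y := fun y => rfl
  have hv : ContDiff ℝ (⊤ : ℕ∞) (u ∘ e) := hu.comp e.contDiff
  have key := cube_spectral a hl hlam hv (by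
    intro n hn
    have := horth n hn
    rw [integral_cubeE] at this
    exact this)
  rw [integral_cubeE, integral_cubeE]
  refine key.trans (le_of_eq ?_)
  congr 1
  funext y
  rw [norm_sq_dual]
  refine Finset.sum_congr rfl fun i _ => ?_
  congr 1
  rw [fderiv_comp y (hu.differentiable (by simp) _) e.differentiableAt, e.fderiv]
  rfl


lemma sq_integral_le {h : ℝ → ℝ} (hc : Continuous h) :
    (∫ t in (0:ℝ)..1, h t) ^ 2 ≤ ∫ t in (0:ℝ)..1, h t ^ 2 := by
  set c := ∫ t in (0:ℝ)..1, h t with hcdef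
  have h0 : 0 ≤ ∫ t in (0:ℝ)..1, (h t - c) ^ 2 :=
    intervalIntegral.integral_nonneg zero_le_one fun t _ => sq_nonneg _
  have e : ∫ t in (0:ℝ)..1, (h t - c) ^ 2 = (∫ t in (0:ℝ)..1, h t ^ 2) - c ^ 2 := by
    have : ∀ t, (h t - c) ^ 2 = (h t ^ 2 - 2 * c * h t) + c ^ 2 := fun t => by ring
    simp only [this]
    rw [intervalIntegral.integral_add, intervalIntegral.integral_sub,
      intervalIntegral.integral_const_mul, ← hcdef]
    · simp; ring
    all_goals apply Continuous.intervalIntegrable; fun_prop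
  linarith

lemma sq_diff_le {d : ℕ} {u : Euc d → ℝ} (hu : ContDiff ℝ (⊤ : ℕ∞) u) (x y : Euc d) {D : ℝ}
    (hD : ‖x - y‖ ≤ D) :
    (u x - u y) ^ 2 ≤ D ^ 2 * ∫ t in (0:ℝ)..1, ‖fderiv ℝ u (x + t • (y - x))‖ ^ 2 := by
  have hc : Continuous (fderiv ℝ u) := hu.continuous_fderiv (by simp)
  have hder : ∀ t : ℝ, HasDerivAt (fun t : ℝ => u (x + t • (y - x)))
      (fderiv ℝ u (x + t • (y - x)) (y - x)) t := by
    intro t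
    have h1 : HasDerivAt (fun t : ℝ => x + t • (y - x)) (y - x) t := by
      simpa using ((hasDerivAt_id t).smul_const (y - x)).const_add x
    exact ((hu.differentiable (by simp) _).hasFDerivAt).comp_hasDerivAt t h1
  have hcont : Continuous fun t : ℝ => fderiv ℝ u (x + t • (y - x)) (y - x) := by fun_prop
  have hftc := intervalIntegral.integral_eq_sub_of_hasDerivAt (a := 0) (b := 1)
    (fun t _ => hder t) (hcont.intervalIntegrable _ _)
  simp only [one_smul, zero_smul, add_zero, add_sub_cancel] at hftc
  have e : (u x - u y) ^ 2 = (∫ t in (0:ℝ)..1, fderiv ℝ u (x + t • (y - x)) (y - x)) ^ 2 := by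
    rw [hftc]; ring
  rw [e]
  refine (sq_integral_le hcont).trans ?_
  rw [← intervalIntegral.integral_const_mul]
  refine intervalIntegral.integral_mono_on zero_le_one ?_ ?_ ?_
  · apply Continuous.intervalIntegrable; fun_prop
  · apply Continuous.intervalIntegrable; fun_prop
  · intro t _
    have h1 := (fderiv ℝ u (x + t • (y - x))).le_opNorm (y - x)
    have h2 : ‖y - x‖ ≤ D := by rwa [norm_sub_rev]
    have h3 : ‖fderiv ℝ u (x + t • (y - x)) (y - x)‖ ≤ ‖fderiv ℝ u (x + t • (y - x))‖ * D :=
      h1.trans (by gcongr)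
    have h4 : ‖fderiv ℝ u (x + t • (y - x)) (y - x)‖ ^ 2 ≤
        (‖fderiv ℝ u (x + t • (y - x))‖ * D) ^ 2 := by gcongr
    rw [Real.norm_eq_abs, sq_abs] at h4
    linarith [h4, mul_pow (‖fderiv ℝ u (x + t • (y - x))‖) D 2]

open scoped ENNReal in
lemma lint_affine {d : ℕ} (w : Euc d) {t : ℝ} (ht : 1/2 ≤ t) {H : Euc d → ℝ≥0∞}
    (hH : Measurable H) : ∫⁻ y, H (w + t • y) ≤ 2 ^ d * ∫⁻ y, H y := by
  have ht0 : 0 < t := by linarith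
  have h1 : ∫⁻ y, H (w + t • y) = ∫⁻ z, H (w + z) ∂(Measure.map (t • ·) (volume : Measure (Euc d))) := by
    rw [lintegral_map (by fun_prop) (by fun_prop)]
  rw [h1, Measure.map_addHaar_smul _ ht0.ne', lintegral_smul_measure, lintegral_add_left_eq_self]
  simp only [finrank_euclideanSpace, Fintype.card_fin, smul_eq_mul]
  gcongr
  rw [abs_of_pos (by positivity), ← inv_pow]
  have : t⁻¹ ≤ 2 := by
    rw [inv_le_comm₀ ht0 (by norm_num)]; linarith
  calc ENNReal.ofReal (t⁻¹ ^ d) ≤ ENNReal.ofReal (2 ^ d) := by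
        apply ENNReal.ofReal_le_ofReal; gcongr
    _ = 2 ^ d := by rw [ENNReal.ofReal_pow (by norm_num)]; simp

open scoped ENNReal in
lemma lint_conv {d : ℕ} {P : Set (Euc d)} (hP : MeasurableSet P) (hconv : Convex ℝ P)
    {G : Euc d → ℝ≥0∞} (hG : Measurable G) {t : ℝ} (ht : t ∈ Set.Icc (0:ℝ) 1) :
    ∫⁻ x in P, ∫⁻ y in P, G (x + t • (y - x)) ≤ 2 ^ d * volume P * ∫⁻ y in P, G y := by
  have main : ∀ s : ℝ, 1/2 ≤ s → s ≤ 1 → ∀ x ∈ P, ∫⁻ y in P, G (x + s • (y - x)) ≤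
      2 ^ d * ∫⁻ y in P, G y := by
    intro s hs1 hs2 x hx
    have hH : Measurable (P.indicator G) := hG.indicator hP
    calc ∫⁻ y in P, G (x + s • (y - x)) ≤ ∫⁻ y in P, P.indicator G ((1 - s) • x + s • y) := by
          refine setLIntegral_mono' hP fun y hy => ?_
          have e : x + s • (y - x) = (1 - s) • x + s • y := by module
          rw [e, Set.indicator_of_mem]
          exact hconv hx hy (by linarith) (by linarith) (by ring)
      _ ≤ ∫⁻ y, P.indicator G ((1 - s) • x + s • y) := setLIntegral_le_lintegral _ _
      _ ≤ 2 ^ d * ∫⁻ y, P.indicator G y := lint_affine _ hs1 hH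
      _ = _ := by rw [lintegral_indicator hP]
  have fin : ∀ s : ℝ, 1/2 ≤ s → s ≤ 1 → ∫⁻ x in P, ∫⁻ y in P, G (x + s • (y - x)) ≤
      2 ^ d * volume P * ∫⁻ y in P, G y := by
    intro s hs1 hs2
    calc ∫⁻ x in P, ∫⁻ y in P, G (x + s • (y - x)) ≤ ∫⁻ x in P, 2 ^ d * ∫⁻ y in P, G y :=
          setLIntegral_mono' hP fun x hx => main s hs1 hs2 x hx
      _ = _ := by rw [setLIntegral_const]; ring
  rcases le_total (1/2) t with h | h
  · exact fin t h ht.2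
  · rw [lintegral_lintegral_swap]
    · have := fin (1 - t) (by linarith) (by linarith [ht.1])
      refine le_trans (le_of_eq ?_) this
      congr 1; funext x; congr 1; funext y; congr 1
      module
    · apply Measurable.aemeasurable
      exact hG.comp (by fun_prop)

theorem poincare_convex {d : ℕ} {P : Set (Euc d)} (hP : MeasurableSet P) (hconv : Convex ℝ P)
    (hb : Bornology.IsBounded P) {D : ℝ} (hD0 : 0 ≤ D) (hD : ∀ x ∈ P, ∀ y ∈ P, ‖x - y‖ ≤ D)
    {u : Euc d → ℝ} (hu : ContDiff ℝ (⊤ : ℕ∞) u) (h0 : ∫ x in P, u x = 0) :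
    ∫ x in P, (u x) ^ 2 ≤ 2 ^ d * D ^ 2 * ∫ x in P, ‖fderiv ℝ u x‖ ^ 2 := by
  have hc : Continuous (fderiv ℝ u) := hu.continuous_fderiv (by simp)
  have hcu := hu.continuous
  have hPfin : volume P ≠ ⊤ := hb.measure_lt_top.ne
  set vol := (volume P).toReal with hvol
  set U := ∫ x in P, (u x) ^ 2 with hU
  set A := ∫ x in P, ‖fderiv ℝ u x‖ ^ 2 with hA
  have hA0 : 0 ≤ A := integral_nonneg fun x => by positivity
  have hU0 : 0 ≤ U := integral_nonneg fun x => by positivity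
  let G : Euc d → ENNReal := fun z => ENNReal.ofReal (‖fderiv ℝ u z‖ ^ 2)
  have hG : Measurable G := by
    apply Measurable.ennreal_ofReal
    exact (by fun_prop : Continuous fun z => ‖fderiv ℝ u z‖ ^ 2).measurable
  have hGA : ∫⁻ y in P, G y = ENNReal.ofReal A := by
    rw [hA, ofReal_integral_eq_lintegral_ofReal]
    · exact integrableOn_of_cont hb (by fun_prop)
    · exact Filter.Eventually.of_forall fun x => by positivity
  rcases eq_or_ne vol 0 with hv | hv
  · have : volume P = 0 := by
      rcases (ENNReal.toReal_eq_zero_iff _).1 hv with h | h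
      · exact h
      · exact absurd h hPfin
    have hU' : U = 0 := by rw [hU]; exact setIntegral_measure_zero _ this
    rw [hU']; positivity
  have hvpos : 0 < vol := lt_of_le_of_ne ENNReal.toReal_nonneg hv.symm
  -- inner integral
  have hinner : ∀ x, ∫⁻ y in P, ENNReal.ofReal ((u x - u y) ^ 2) =
      ENNReal.ofReal (vol * u x ^ 2 + U) := by
    intro x
    rw [← ofReal_integral_eq_lintegral_ofReal]
    · congr 1
      have : ∀ y, (u x - u y) ^ 2 = (u x ^ 2 - 2 * u x * u y) + u y ^ 2 := fun y => by ring
      simp only [this]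
      rw [integral_add, integral_sub, integral_const_mul, h0, setIntegral_const, ← hU]
      · simp [Measure.real, hvol]
      all_goals exact integrableOn_of_cont hb (by fun_prop)
    · exact integrableOn_of_cont hb (by fun_prop)
    · exact Filter.Eventually.of_forall fun x => by positivity
  have houter : ∫⁻ x in P, ∫⁻ y in P, ENNReal.ofReal ((u x - u y) ^ 2) =
      ENNReal.ofReal (2 * vol * U) := by
    simp only [hinner]
    rw [← ofReal_integral_eq_lintegral_ofReal]
    · congr 1
      rw [integral_add, integral_const_mul, setIntegral_const, ← hU]
      · simp [Measure.real, hvol]; ring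
      all_goals exact integrableOn_of_cont hb (by fun_prop)
    · exact integrableOn_of_cont hb (by fun_prop)
    · exact Filter.Eventually.of_forall fun x => by positivity
  have hpt : ∀ x ∈ P, ∀ y ∈ P, ENNReal.ofReal ((u x - u y) ^ 2) ≤
      ENNReal.ofReal (D ^ 2) * ∫⁻ t in Set.Icc (0:ℝ) 1, G (x + t • (y - x)) := by
    intro x hx y hy
    have h1 := ENNReal.ofReal_le_ofReal (sq_diff_le hu x y (hD x hx y hy))
    rw [ENNReal.ofReal_mul (by positivity), intervalIntegral.integral_of_le zero_le_one,
      ← integral_Icc_eq_integral_Ioc, ofReal_integral_eq_lintegral_ofReal] at h1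
    · exact h1
    · apply Continuous.integrableOn_Icc; fun_prop
    · exact Filter.Eventually.of_forall fun x => by positivity
  have hGm : Measurable (fun p : Euc d × Euc d × ℝ => G (p.1 + p.2.2 • (p.2.1 - p.1))) :=
    hG.comp (by fun_prop)
  have hbig : ENNReal.ofReal (2 * vol * U) ≤
      ENNReal.ofReal (D ^ 2) * (2 ^ d * volume P * ENNReal.ofReal A) := by
    rw [← houter]
    calc ∫⁻ x in P, ∫⁻ y in P, ENNReal.ofReal ((u x - u y) ^ 2)
        ≤ ∫⁻ x in P, ∫⁻ y in P, ENNReal.ofReal (D ^ 2) *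
            ∫⁻ t in Set.Icc (0:ℝ) 1, G (x + t • (y - x)) :=
          setLIntegral_mono' hP fun x hx => setLIntegral_mono' hP fun y hy => hpt x hx y hy
      _ = ENNReal.ofReal (D ^ 2) * ∫⁻ x in P, ∫⁻ y in P,
            ∫⁻ t in Set.Icc (0:ℝ) 1, G (x + t • (y - x)) := by
          rw [← lintegral_const_mul' _ _ ENNReal.ofReal_ne_top]
          congr 1; funext x
          rw [← lintegral_const_mul' _ _ ENNReal.ofReal_ne_top]
      _ = ENNReal.ofReal (D ^ 2) * ∫⁻ x in P, ∫⁻ t in Set.Icc (0:ℝ) 1, ∫⁻ y in P,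
             G (x + t • (y - x)) := by
          congr 2; funext x
          rw [lintegral_lintegral_swap]
          apply Measurable.aemeasurable
          exact hG.comp (by fun_prop)
      _ = ENNReal.ofReal (D ^ 2) * ∫⁻ t in Set.Icc (0:ℝ) 1, ∫⁻ x in P, ∫⁻ y in P,
             G (x + t • (y - x)) := by
          congr 1
          rw [lintegral_lintegral_swap]
          apply Measurable.aemeasurable
          refine Measurable.lintegral_prod_right' (f := fun q : (Euc d × ℝ) × Euc d =>
            G (q.1.1 + q.1.2 • (q.2 - q.1.1))) ?_
          exact hG.comp (by fun_prop)
      _ ≤ ENNReal.ofReal (D ^ 2) * ∫⁻ t in Set.Icc (0:ℝ) 1,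
            2 ^ d * volume P * ∫⁻ y in P, G y := by
          exact mul_le_mul' le_rfl
            (setLIntegral_mono' measurableSet_Icc fun t ht => lint_conv hP hconv hG ht)
      _ = _ := by
          rw [setLIntegral_const, hGA]; simp
  have hreal : 2 * vol * U ≤ D ^ 2 * (2 ^ d * vol * A) := by
    rw [← ENNReal.ofReal_toReal hPfin] at hbig
    rw [← hvol] at hbig
    have e : ENNReal.ofReal (D ^ 2) * (2 ^ d * ENNReal.ofReal vol * ENNReal.ofReal A) =
        ENNReal.ofReal (D ^ 2 * (2 ^ d * vol * A)) := by
      rw [ENNReal.ofReal_mul (by positivity), ENNReal.ofReal_mul (by positivity),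
        ENNReal.ofReal_mul (by positivity), ENNReal.ofReal_pow (by norm_num : (0:ℝ) ≤ 2)]
      simp
    rw [e, ENNReal.ofReal_le_ofReal_iff (by positivity)] at hbig
    exact hbig
  have h2 : vol * U ≤ vol * (2 ^ d * D ^ 2 * A) := by
    have : 0 ≤ vol * U := by positivity
    nlinarith
  exact le_of_mul_le_mul_left h2 hvpos


def latT (k : ℕ) : Set ℝ := Set.Ico (k:ℝ) (k+1) ∪ Set.Ioo (-((k:ℝ)+1)) (-(k:ℝ))

lemma latT_floor {k : ℕ} {t : ℝ} (h : t ∈ latT k) : ⌊|t|⌋₊ = k := by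
  rw [Nat.floor_eq_iff (abs_nonneg t)]
  have hk : (0:ℝ) ≤ k := Nat.cast_nonneg k
  rcases h with h | h
  · rw [abs_of_nonneg (hk.trans h.1)]; exact ⟨h.1, h.2⟩
  · rw [abs_of_neg (by linarith [h.2])]; exact ⟨by linarith [h.2], by linarith [h.1]⟩

lemma latT_meas (k : ℕ) : MeasurableSet (latT k) := measurableSet_Ico.union measurableSet_Ioo

lemma latT_vol (k : ℕ) : volume (latT k) = 2 := by
  have hk : (0:ℝ) ≤ k := Nat.cast_nonneg k
  rw [latT, measure_union _ measurableSet_Ioo, Real.volume_Ico, Real.volume_Ioo]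
  · rw [← ENNReal.ofReal_add (by linarith) (by linarith)]
    rw [show (k:ℝ) + 1 - k + (-(k:ℝ) - -((k:ℝ)+1)) = 2 by ring]; simp
  · rw [Set.disjoint_left]; intro t h1 h2; linarith [h1.1, h2.2]

def latE {d : ℕ} (n : Fin d → ℕ) : Set (Euc d) := {x | ∀ i, x i ∈ latT (n i)}

lemma latE_eq {d : ℕ} (n : Fin d → ℕ) :
    latE n = (fun x : Euc d => WithLp.ofLp x) ⁻¹' (Set.univ.pi fun i => latT (n i)) := by
  ext x; simp [latE]

lemma latE_meas {d : ℕ} (n : Fin d → ℕ) : MeasurableSet (latE n) := by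
  rw [latE_eq]
  exact (PiLp.volume_preserving_ofLp (Fin d)).measurable
    (MeasurableSet.univ_pi fun i => latT_meas _)

lemma latE_vol {d : ℕ} (n : Fin d → ℕ) : volume (latE n) = 2 ^ d := by
  rw [latE_eq, (PiLp.volume_preserving_ofLp (Fin d)).measure_preimage
    (MeasurableSet.univ_pi fun i => latT_meas _).nullMeasurableSet, volume_pi_pi]
  simp [latT_vol]

lemma latE_norm {d : ℕ} {n : Fin d → ℕ} {R : ℝ} (hR : 0 ≤ R)
    (hn : ∑ i, (n i : ℝ)^2 ≤ R^2) {x : Euc d} (hx : x ∈ latE n) : ‖x‖ ≤ R + √d := by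
  let s : Euc d := WithLp.toLp 2 fun i => if 0 ≤ x i then (n i : ℝ) else -(n i:ℝ)
  have h1 : ‖s‖ ≤ R := by
    rw [EuclideanSpace.norm_eq]
    apply Real.sqrt_le_iff.2 ⟨hR, le_trans (le_of_eq _) hn⟩
    apply Finset.sum_congr rfl
    intro i _
    simp only [s]
    split_ifs <;> simp
  have h2 : ‖x - s‖ ≤ √d := by
    rw [EuclideanSpace.norm_eq]
    apply Real.sqrt_le_sqrt
    have : ∀ i ∈ Finset.univ, ‖(x - s) i‖^2 ≤ (1:ℝ) := by
      intro i _
      have hk : (0:ℝ) ≤ n i := Nat.cast_nonneg _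
      have : |x i - s i| ≤ 1 := by
        rw [abs_le]
        simp only [s]
        rcases hx i with h | h
        · rw [if_pos (hk.trans h.1)]; constructor <;> linarith [h.1, h.2]
        · rw [if_neg (by linarith [h.2])]; constructor <;> linarith [h.1, h.2]
      rw [PiLp.sub_apply, Real.norm_eq_abs]
      nlinarith [abs_nonneg (x i - s i)]
    simpa using Finset.sum_le_sum this
  calc ‖x‖ = ‖s + (x - s)‖ := by congr 1; abel
    _ ≤ _ := (norm_add_le _ _).trans (add_le_add h1 h2)

lemma lattice_count {d : ℕ} {R : ℝ} (hR : 0 ≤ R) (S : Finset (Fin d → ℕ))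
    (hS : ∀ n ∈ S, ∑ i, (n i : ℝ)^2 ≤ R^2) :
    (S.card : ℝ) * 2^d ≤ (volume (Metric.ball (0 : Euc d) 1)).toReal * (R + √d)^d := by
  have hdisj : (S : Set (Fin d → ℕ)).PairwiseDisjoint (latE (d := d)) := by
    intro a _ b _ hab
    rw [Function.onFun, Set.disjoint_left]
    intro x hxa hxb
    exact hab (funext fun i => (latT_floor (hxa i)).symm.trans (latT_floor (hxb i)))
  have h1 : volume (⋃ n ∈ S, latE n) = (S.card : ENNReal) * 2^d := by
    rw [measure_biUnion_finset hdisj fun n _ => latE_meas n]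
    simp [latE_vol]
  have h2 : (⋃ n ∈ S, latE n) ⊆ Metric.closedBall (0 : Euc d) (R + √d) := by
    apply Set.iUnion₂_subset
    intro n hn x hx
    rw [mem_closedBall_zero_iff]
    exact latE_norm hR (hS n hn) hx
  have h3 := measure_mono (μ := volume) h2
  rw [h1, Measure.addHaar_closedBall _ _ (by positivity)] at h3
  have h4 := ENNReal.toReal_mono (by
    apply ENNReal.mul_ne_top ENNReal.ofReal_ne_top measure_ball_lt_top.ne) h3
  rw [ENNReal.toReal_mul, ENNReal.toReal_mul, ENNReal.toReal_ofReal (by positivity)] at h4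
  simp only [ENNReal.toReal_natCast, ENNReal.toReal_pow, ENNReal.toReal_ofNat,
    finrank_euclideanSpace, Fintype.card_fin] at h4
  linarith

lemma lowModes_finite {d : ℕ} {l lam : ℝ} (hl : 0 < l) (hlam : 0 < lam) :
    {n : Fin d → ℕ | ∑ i, ((n i : ℝ) * π / l)^2 < lam}.Finite := by
  apply (Set.Finite.pi' (fun _ : Fin d => Set.finite_Iic ⌈l * √lam / π⌉₊)).subset
  intro n hn i
  simp only [Set.mem_ofPred_eq] at hn
  have h1 : ((n i : ℝ) * π / l)^2 ≤ lam := by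
    refine le_trans ?_ hn.le
    exact Finset.single_le_sum (f := fun i => ((n i : ℝ) * π / l)^2)
      (fun _ _ => sq_nonneg _) (Finset.mem_univ i)
  have h2 : (n i : ℝ) * π / l ≤ √lam := Real.le_sqrt_of_sq_le h1
  rw [div_le_iff₀ hl] at h2
  have h3 : (n i : ℝ) ≤ l * √lam / π := by
    rw [le_div_iff₀ Real.pi_pos]; linarith
  simp only [Set.mem_Iic]
  exact_mod_cast h3.trans (Nat.le_ceil _)

def lowModes (d : ℕ) {l lam : ℝ} (hl : 0 < l) (hlam : 0 < lam) : Finset (Fin d → ℕ) :=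
  (lowModes_finite (d := d) hl hlam).toFinset

lemma lowModes_card (d : ℕ) {l lam : ℝ} (hl : 0 < l) (hlam : 0 < lam) :
    ((lowModes d hl hlam).card : ℝ) * 2^d ≤
      (volume (Metric.ball (0 : Euc d) 1)).toReal * (l * √lam / π + √d)^d := by
  apply lattice_count (by positivity)
  intro n hn
  simp only [lowModes, Set.Finite.mem_toFinset, Set.mem_ofPred_eq] at hn
  rw [div_pow, mul_pow, Real.sq_sqrt hlam.le, le_div_iff₀ (by positivity)]
  have : ∑ i, ((n i : ℝ) * π / l)^2 = (∑ i, (n i : ℝ)^2) * (π^2 / l^2) := by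
    rw [Finset.sum_mul]; apply Finset.sum_congr rfl; intro i _; ring
  rw [this, ← mul_div_assoc, div_lt_iff₀ (by positivity)] at hn
  linarith


lemma cubeE_diam {d : ℕ} {a : Fin d → ℝ} {l : ℝ} (hl : 0 ≤ l) {x y : Euc d}
    (hx : x ∈ cubeE a l) (hy : y ∈ cubeE a l) : ‖x - y‖ ≤ √d * l := by
  rw [EuclideanSpace.norm_eq]
  apply Real.sqrt_le_iff.2 ⟨by positivity, ?_⟩
  have : ∀ i ∈ Finset.univ, ‖(x - y) i‖^2 ≤ l^2 := by
    intro i _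
    rw [PiLp.sub_apply, Real.norm_eq_abs, sq_abs]
    apply sq_le_sq'
    · linarith [(hx i).1, (hy i).2]
    · linarith [(hx i).2, (hy i).1]
  have h := Finset.sum_le_sum this
  rw [mul_pow, Real.sq_sqrt (Nat.cast_nonneg d)]
  simpa using h

lemma cubeE_bounded {d : ℕ} (a : Fin d → ℝ) {l : ℝ} (hl : 0 ≤ l) :
    Bornology.IsBounded (cubeE a l) :=
  Metric.isBounded_iff.2 ⟨√d * l, fun x hx y hy => by
    rw [dist_eq_norm]; exact cubeE_diam hl hx hy⟩

lemma cubeE_convex {d : ℕ} (a : Fin d → ℝ) (l : ℝ) : Convex ℝ (cubeE a l) := by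
  intro x hx y hy s t hs ht hst i
  have h := (convex_Ico (a i) (a i + l)) (hx i) (hy i) hs ht hst
  simpa using h

def gcell {d : ℕ} (l : ℝ) (z : Fin d → ℤ) : Set (Euc d) := cubeE (fun i => l * z i) l

lemma mem_gcell {d : ℕ} {l : ℝ} (hl : 0 < l) {z : Fin d → ℤ} {x : Euc d} :
    x ∈ gcell l z ↔ ∀ i, ⌊x i / l⌋ = z i := by
  simp only [gcell, cubeE, Set.mem_ofPred_eq]
  refine forall_congr' fun i => ?_
  rw [Int.floor_eq_iff, le_div_iff₀ hl, div_lt_iff₀ hl]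
  constructor <;> rintro ⟨h1, h2⟩ <;> constructor <;> nlinarith

lemma gcell_disj {d : ℕ} {l : ℝ} (hl : 0 < l) {z w : Fin d → ℤ} (h : z ≠ w) :
    Disjoint (gcell l z) (gcell l w) := by
  rw [Set.disjoint_left]
  intro x h1 h2
  exact h (funext fun i => ((mem_gcell hl).1 h1 i).symm.trans ((mem_gcell hl).1 h2 i))

lemma gridZ_finite {d : ℕ} {l : ℝ} (hl : 0 < l) {Ω : Set (Euc d)} (hb : Bornology.IsBounded Ω) :
    {z : Fin d → ℤ | (gcell l z ∩ Ω).Nonempty}.Finite := by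
  obtain ⟨R, hR⟩ := hb.exists_norm_le
  apply (Set.Finite.pi' (fun _ : Fin d => Set.finite_Icc ⌊-R / l⌋ ⌊R / l⌋)).subset
  rintro z ⟨x, hx, hxΩ⟩ i
  rw [← (mem_gcell hl).1 hx i]
  have h1 : |x i| ≤ R := by
    rw [← Real.norm_eq_abs]; exact (PiLp.norm_apply_le x i).trans (hR x hxΩ)
  rw [abs_le] at h1
  exact ⟨Int.floor_le_floor (by gcongr; exact h1.1), Int.floor_le_floor (by gcongr; exact h1.2)⟩

def gridZ {d : ℕ} {l : ℝ} (hl : 0 < l) {Ω : Set (Euc d)} (hb : Bornology.IsBounded Ω) :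
    Finset (Fin d → ℤ) := (gridZ_finite hl hb).toFinset

lemma mem_gridZ {d : ℕ} {l : ℝ} (hl : 0 < l) {Ω : Set (Euc d)} (hb : Bornology.IsBounded Ω)
    {z : Fin d → ℤ} : z ∈ gridZ hl hb ↔ (gcell l z ∩ Ω).Nonempty := by
  simp [gridZ]

lemma integral_grid {d : ℕ} {l : ℝ} (hl : 0 < l) {Ω : Set (Euc d)} (hb : Bornology.IsBounded Ω)
    (hm : MeasurableSet Ω) {f : Euc d → ℝ} (hf : Continuous f) :
    ∫ x in Ω, f x = ∑ z ∈ gridZ hl hb, ∫ x in gcell l z ∩ Ω, f x := by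
  have e : Ω = ⋃ z ∈ gridZ hl hb, gcell l z ∩ Ω := by
    ext x
    simp only [Set.mem_iUnion, mem_gridZ, exists_prop]
    constructor
    · intro hx
      have : x ∈ gcell l (fun i => ⌊x i / l⌋) := (mem_gcell hl).2 fun i => rfl
      exact ⟨_, ⟨x, this, hx⟩, this, hx⟩
    · rintro ⟨z, _, _, h⟩; exact h
  conv_lhs => rw [e]
  apply integral_biUnion_finset
  · intro z _; exact (measurableSet_cubeE _ _).inter hm
  · intro z _ w _ h
    exact (gcell_disj hl h).mono Set.inter_subset_left Set.inter_subset_left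
  · intro z _
    exact integrableOn_of_cont (hb.subset Set.inter_subset_right) hf

def subA {d : ℕ} (a : Fin d → ℝ) (l : ℝ) {m : ℕ} (j : Fin d → Fin m) : Fin d → ℝ :=
  fun i => a i + l / m * ((j i : ℕ) : ℝ)

lemma subA_floor {d : ℕ} {a : Fin d → ℝ} {l : ℝ} (hl : 0 < l) {m : ℕ} (hm : 0 < m)
    {j : Fin d → Fin m} {x : Euc d} (hx : x ∈ cubeE (subA a l j) (l / m)) (i : Fin d) :
    ⌊(x i - a i) / (l / m)⌋₊ = (j i : ℕ) := by
  have hq : 0 < l / m := by positivity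
  obtain ⟨h1, h2⟩ := hx i
  simp only [subA] at h1 h2
  have h3 : 0 ≤ l / m * ((j i : ℕ) : ℝ) := by positivity
  rw [Nat.floor_eq_iff (div_nonneg (by linarith) hq.le), le_div_iff₀ hq, div_lt_iff₀ hq]
  constructor <;> nlinarith

lemma cubeE_sub {d : ℕ} (a : Fin d → ℝ) {l : ℝ} (hl : 0 < l) {m : ℕ} (hm : 0 < m) :
    cubeE a l = ⋃ j : Fin d → Fin m, cubeE (subA a l j) (l / m) := by
  have hq : 0 < l / m := by positivity
  have hm' : (0:ℝ) < m := by exact_mod_cast hm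
  have hlm : l = l / m * m := by field_simp
  ext x
  simp only [Set.mem_iUnion]
  constructor
  · intro hx
    have h0 : ∀ i, 0 ≤ (x i - a i) / (l / m) := fun i =>
      div_nonneg (by linarith [(hx i).1]) hq.le
    have hlt : ∀ i, ⌊(x i - a i) / (l / m)⌋₊ < m := by
      intro i
      rw [Nat.floor_lt (h0 i), div_lt_iff₀ hq]
      have := (hx i).2
      nlinarith
    refine ⟨fun i => ⟨_, hlt i⟩, fun i => ?_⟩
    simp only [subA]
    have h1 := Nat.floor_le (h0 i)
    have h2 := Nat.lt_floor_add_one ((x i - a i) / (l / m))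
    rw [le_div_iff₀ hq] at h1
    rw [div_lt_iff₀ hq] at h2
    constructor <;> nlinarith
  · rintro ⟨j, hx⟩ i
    obtain ⟨h1, h2⟩ := hx i
    simp only [subA] at h1 h2
    have h3 : 0 ≤ l / m * ((j i : ℕ) : ℝ) := by positivity
    have h4 : ((j i : ℕ) : ℝ) + 1 ≤ m := by exact_mod_cast (j i).2
    have h5 := mul_le_mul_of_nonneg_left h4 hq.le
    constructor
    · linarith
    · nlinarith

lemma integral_sub {d : ℕ} {a : Fin d → ℝ} {l : ℝ} (hl : 0 < l) {m : ℕ} (hm : 0 < m)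
    {Ω : Set (Euc d)} (hb : Bornology.IsBounded Ω)
    (hΩm : MeasurableSet Ω) {f : Euc d → ℝ} (hf : Continuous f) :
    ∫ x in cubeE a l ∩ Ω, f x =
      ∑ j : Fin d → Fin m, ∫ x in cubeE (subA a l j) (l / m) ∩ Ω, f x := by
  rw [cubeE_sub a hl hm, Set.iUnion_inter]
  apply integral_iUnion_fintype
  · intro z; exact (measurableSet_cubeE _ _).inter hΩm
  · intro z w h
    refine Set.disjoint_left.2 fun x h1 h2 => h (funext fun i => Fin.ext ?_)
    exact (subA_floor hl hm h1.1 i).symm.trans (subA_floor hl hm h2.1 i)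
  · intro z
    exact integrableOn_of_cont (hb.subset Set.inter_subset_right) hf

lemma bad_cell {d : ℕ} {a : Fin d → ℝ} {l : ℝ} (hl : 0 < l) {m : ℕ} (hm : 0 < m)
    {Ω : Set (Euc d)} (hΩ : IsConvexDomain Ω) {lam : ℝ} (hlam : 0 < lam)
    (hm2 : lam * (2^d * (d * (l/m)^2)) ≤ 1) {u : Euc d → ℝ} (hu : ContDiff ℝ (⊤ : ℕ∞) u)
    (h0 : ∀ j : Fin d → Fin m, ∫ x in cubeE (subA a l j) (l / m) ∩ Ω, u x = 0) :
    lam * ∫ x in cubeE a l ∩ Ω, (u x)^2 ≤ ∫ x in cubeE a l ∩ Ω, ‖fderiv ℝ u x‖^2 := by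
  obtain ⟨_, ho, hb, hc⟩ := hΩ
  have hcf : Continuous (fderiv ℝ u) := hu.continuous_fderiv (by simp)
  have hcu := hu.continuous
  have hq : 0 < l / m := by positivity
  rw [integral_sub hl hm hb ho.measurableSet (by fun_prop),
    integral_sub hl hm hb ho.measurableSet (f := fun x => ‖fderiv ℝ u x‖^2) (by fun_prop),
    Finset.mul_sum]
  apply Finset.sum_le_sum
  intro j _
  have hp := poincare_convex (P := cubeE (subA a l j) (l / m) ∩ Ω) (D := √d * (l/m))
    ((measurableSet_cubeE _ _).inter ho.measurableSet)
    ((cubeE_convex _ _).inter hc) (hb.subset Set.inter_subset_right) (by positivity)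
    (fun x hx y hy => cubeE_diam hq.le hx.1 hy.1) hu (h0 j)
  have hnn : 0 ≤ ∫ x in cubeE (subA a l j) (l / m) ∩ Ω, ‖fderiv ℝ u x‖^2 :=
    integral_nonneg fun x => by positivity
  rw [mul_pow, Real.sq_sqrt (Nat.cast_nonneg d)] at hp
  calc _ ≤ lam * _ := mul_le_mul_of_nonneg_left hp hlam.le
    _ = (lam * (2^d * (d * (l/m)^2))) * _ := by ring
    _ ≤ 1 * _ := mul_le_mul_of_nonneg_right hm2 hnn
    _ = _ := one_mul _

open Classical in
def goodZ {d : ℕ} {l : ℝ} (hl : 0 < l) {Ω : Set (Euc d)} (hb : Bornology.IsBounded Ω) :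
    Finset (Fin d → ℤ) := (gridZ hl hb).filter (fun z => gcell l z ⊆ Ω)

open Classical in
def badZ {d : ℕ} {l : ℝ} (hl : 0 < l) {Ω : Set (Euc d)} (hb : Bornology.IsBounded Ω) :
    Finset (Fin d → ℤ) := (gridZ hl hb).filter (fun z => ¬ gcell l z ⊆ Ω)

lemma card_cells {d : ℕ} {l : ℝ} (hl : 0 < l) (S : Finset (Fin d → ℤ)) {B : Set (Euc d)}
    (hB : volume B ≠ ⊤) (hS : ∀ z ∈ S, gcell l z ⊆ B) :
    (S.card : ℝ) * l^d ≤ (volume B).toReal := by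
  have h1 : volume (⋃ z ∈ S, gcell l z) = (S.card : ENNReal) * ENNReal.ofReal (l^d) := by
    rw [measure_biUnion_finset (fun z _ w _ h => gcell_disj hl h)
      fun z _ => measurableSet_cubeE _ _]
    simp [gcell, volume_cubeE _ hl.le]
  have h3 := ENNReal.toReal_mono hB (measure_mono (μ := volume) (Set.iUnion₂_subset hS))
  rw [h1, ENNReal.toReal_mul, ENNReal.toReal_ofReal (by positivity)] at h3
  simpa using h3

lemma bad_subset {d : ℕ} {l : ℝ} (hl : 0 < l) {Ω : Set (Euc d)} (ho : IsOpen Ω)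
    {z : Fin d → ℤ} (h1 : (gcell l z ∩ Ω).Nonempty) (h2 : ¬ gcell l z ⊆ Ω) :
    gcell l z ⊆ Metric.cthickening (√d * l) (frontier Ω) := by
  have hpc : IsPreconnected (gcell l z) := (cubeE_convex _ _).isPreconnected
  have : ∃ p ∈ gcell l z, p ∈ frontier Ω := by
    by_contra hcon
    push Not at hcon
    obtain ⟨y, hy, hyΩ⟩ := Set.not_subset.1 h2
    have hv : ∀ p ∈ gcell l z, p ∉ Ω → p ∈ (closure Ω)ᶜ := by
      intro p hp hpΩ hcl
      exact hcon p hp (by rw [ho.frontier_eq]; exact ⟨hcl, hpΩ⟩)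
    obtain ⟨q, _, hq1, hq2⟩ := hpc Ω (closure Ω)ᶜ ho isClosed_closure.isOpen_compl
      (fun p hp => by
        by_cases h : p ∈ Ω
        · exact Or.inl h
        · exact Or.inr (hv p hp h)) h1 ⟨y, hy, hv y hy hyΩ⟩
    exact hq2 (subset_closure hq1)
  obtain ⟨p, hp, hpf⟩ := this
  intro x hx
  apply Metric.mem_cthickening_of_dist_le x p _ _ hpf
  rw [dist_eq_norm]
  exact cubeE_diam hl.le hx hp

theorem bracket {d' : ℕ} {Ω : Set (Euc (d'+1))} (hΩ : IsConvexDomain Ω) {l : ℝ} (hl : 0 < l)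
    {lam : ℝ} (hlam : 0 < lam) {m : ℕ} (hm : 0 < m)
    (hm2 : lam * (2^(d'+1) * (((d'+1 : ℕ) : ℝ) * (l/m)^2)) ≤ 1) (k : ℕ)
    (hk : (volume Ω).toReal / l^(d'+1) * ((volume (Metric.ball (0 : Euc (d'+1)) 1)).toReal *
        (l * √lam / π + √((d'+1 : ℕ) : ℝ))^(d'+1) / 2^(d'+1)) +
      (volume (Metric.cthickening (√((d'+1 : ℕ) : ℝ) * l) (frontier Ω))).toReal / l^(d'+1)
        * (m:ℝ)^(d'+1) ≤ k) :
    lam ≤ neumannEigenvalue k Ω := by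
  obtain ⟨hne, ho, hb, hc⟩ := id hΩ
  have hG := card_cells hl (goodZ hl hb) hb.measure_lt_top.ne (fun z hz => by
    simp only [goodZ, Finset.mem_filter] at hz; exact hz.2)
  have hfb : Bornology.IsBounded (frontier Ω) := hb.closure.subset frontier_subset_closure
  have hB := card_cells hl (badZ hl hb)
    (hfb.cthickening (δ := √((d'+1 : ℕ) : ℝ) * l)).measure_lt_top.ne (fun z hz => by
    simp only [badZ, Finset.mem_filter, mem_gridZ] at hz; exact bad_subset hl ho hz.1 hz.2)
  have hL := lowModes_card (d'+1) hl hlam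
  have hld : 0 < l^(d'+1) := by positivity
  rw [← le_div_iff₀ hld] at hG hB
  rw [← le_div_iff₀ (by positivity)] at hL
  have hcard : Fintype.card ((goodZ hl hb × lowModes (d'+1) hl hlam) ⊕
      (badZ hl hb × (Fin (d'+1) → Fin m))) ≤ k := by
    simp only [Fintype.card_sum, Fintype.card_prod, Fintype.card_coe, Fintype.card_fun,
      Fintype.card_fin]
    have : (((goodZ hl hb).card * (lowModes (d'+1) hl hlam).card + (badZ hl hb).card * m^(d'+1)
      : ℕ) : ℝ) ≤ k := by
      refine le_trans ?_ hk
      push_cast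
      gcongr
      · simpa using hL
      · simpa using hB
    exact_mod_cast this
  refine minmax_lower (Nat.succ_pos d') hΩ k lam hcard
    (Sum.elim (fun p => gcell l p.1.1)
      (fun p => cubeE (subA (fun i => l * p.1.1 i) l p.2) (l / m) ∩ Ω)) ?_
    (Sum.elim (fun p x => cosP (fun i => l * p.1.1 i) l (fun j => (p.2.1 j : ℝ)) (WithLp.ofLp x))
      (fun p x => 1)) ?_ ?_
  · rintro (p | p)
    · exact cubeE_bounded _ hl.le
    · exact hb.subset Set.inter_subset_right
  · rintro (p | p)
    · exact (cosP_smooth _ _ _).continuous.comp (PiLp.continuous_ofLp 2 _)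
    · exact continuous_const
  · intro u hu h0
    have hcf : Continuous (fderiv ℝ u) := hu.continuous_fderiv (by simp)
    have hcu := hu.continuous
    rw [integral_grid hl hb ho.measurableSet (by fun_prop),
      integral_grid hl hb ho.measurableSet (f := fun x => ‖fderiv ℝ u x‖^2) (by fun_prop),
      Finset.mul_sum]
    apply Finset.sum_le_sum
    intro z hz
    by_cases hzg : gcell l z ⊆ Ω
    · rw [Set.inter_eq_left.2 hzg]
      apply cube_spectral_E _ hl hlam hu
      intro n hn
      exact h0 (Sum.inl (⟨z, by simp only [goodZ, Finset.mem_filter]; exact ⟨hz, hzg⟩⟩,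
        ⟨n, by simp only [lowModes, Set.Finite.mem_toFinset, Set.mem_ofPred_eq]; exact hn⟩))
    · apply bad_cell hl hm hΩ hlam hm2 hu
      intro j
      have := h0 (Sum.inr (⟨z, by simp only [badZ, Finset.mem_filter]; exact ⟨hz, hzg⟩⟩, j))
      simpa using this


theorem weyl_lower {d' : ℕ} {Ω : Set (Euc (d'+1))} (hΩ : IsConvexDomain Ω) {q : ℝ} (hq0 : 0 < q)
    (hq1 : q < 1) : ∀ᶠ k : ℕ in atTop,
      (q * (2 * π) / ((volume (Metric.ball (0 : Euc (d'+1)) 1)).toReal * (volume Ω).toReal)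
        ^ ((1:ℝ) / ((d'+1 : ℕ) : ℝ)) * (k:ℝ) ^ ((1:ℝ) / ((d'+1 : ℕ) : ℝ)))^2
      ≤ neumannEigenvalue k Ω := by
  obtain ⟨hne, ho, hb, hc⟩ := id hΩ
  set V := (volume Ω).toReal with hV
  set w := (volume (Metric.ball (0 : Euc (d'+1)) 1)).toReal with hw
  have hVpos : 0 < V := ENNReal.toReal_pos (ho.measure_pos volume hne).ne' hb.measure_lt_top.ne
  have hwpos : 0 < w := ENNReal.toReal_pos (Metric.measure_ball_pos volume 0 one_pos).ne'
    measure_ball_lt_top.ne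
  have hdpos : (0:ℝ) < ((d'+1 : ℕ) : ℝ) := by positivity
  have hroot : ∀ y : ℝ, 0 ≤ y → (y ^ ((1:ℝ) / ((d'+1 : ℕ) : ℝ)))^(d'+1) = y := by
    intro y hy
    rw [one_div]
    exact Real.rpow_inv_natCast_pow hy (Nat.succ_ne_zero d')
  set A := (w * V) ^ ((1:ℝ) / ((d'+1 : ℕ) : ℝ)) with hA
  have hApos : 0 < A := by positivity
  have hAd : A^(d'+1) = w * V := hroot _ (by positivity)
  set σ := q * (2 * π) / A with hσ
  have hσpos : 0 < σ := by positivity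
  set C := √(2^(d'+1) * ((d'+1 : ℕ) : ℝ)) with hC
  have hCpos : 0 < C := by positivity
  -- choose the mesh size
  have hqd : q^(d'+1) < 1 := pow_lt_one₀ hq0.le hq1 (Nat.succ_ne_zero d')
  obtain ⟨l, hlpos, hl⟩ : ∃ l : ℝ, 0 < l ∧
      (volume (Metric.cthickening (√((d'+1 : ℕ) : ℝ) * l) (frontier Ω))).toReal *
        (C * σ)^(d'+1) < 1 - q^(d'+1) := by
    have hfc : IsCompact (frontier Ω) :=
      (hb.isCompact_closure).of_isClosed_subset isClosed_frontier frontier_subset_closure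
    have t1 := tendsto_measure_cthickening_of_isCompact (μ := volume) hfc
    rw [hc.addHaar_frontier volume] at t1
    have t2 : Tendsto (fun l : ℝ => √((d'+1 : ℕ) : ℝ) * l) (nhds 0) (nhds 0) := by
      have : Continuous (fun l : ℝ => √((d'+1 : ℕ) : ℝ) * l) := by fun_prop
      simpa using this.tendsto 0
    have t3 := ((ENNReal.tendsto_toReal ENNReal.zero_ne_top).comp (t1.comp t2)).mul_const
      ((C * σ)^(d'+1))
    simp only [ENNReal.toReal_zero, zero_mul] at t3
    have t4 := (t3.eventually (gt_mem_nhds (sub_pos.2 hqd))).filter_mono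
      (nhdsWithin_le_nhds (s := Set.Ioi 0))
    obtain ⟨l, h1, h2⟩ := (t4.and self_mem_nhdsWithin).exists
    exact ⟨l, h2, h1⟩
  set η := (volume (Metric.cthickening (√((d'+1 : ℕ) : ℝ) * l) (frontier Ω))).toReal with hη
  have hη0 : 0 ≤ η := ENNReal.toReal_nonneg
  set F : ℝ → ℝ := fun y => V * w * ((σ / π + √((d'+1 : ℕ) : ℝ) / l * y) / 2)^(d'+1) +
    η * (C * σ + y / l)^(d'+1) with hF
  have hF0 : F 0 < 1 := by
    have e : V * w * (σ / π / 2)^(d'+1) = q^(d'+1) := by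
      have : σ / π / 2 = q / A := by rw [hσ]; field_simp
      rw [this, div_pow, hAd]; field_simp
    simp only [hF, mul_zero, add_zero, zero_div]
    rw [e]; linarith
  have hFc : Continuous F := by fun_prop
  have hT : Tendsto (fun k : ℕ => (k:ℝ) ^ ((1:ℝ) / ((d'+1 : ℕ) : ℝ))) atTop atTop :=
    (tendsto_rpow_atTop (by positivity)).comp tendsto_natCast_atTop_atTop
  have hev := ((hFc.tendsto 0).comp (tendsto_inv_atTop_zero.comp hT)).eventually
    (gt_mem_nhds hF0)
  filter_upwards [hev, eventually_ge_atTop 1] with k hk hk1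
  simp only [Function.comp] at hk
  set T := (k:ℝ) ^ ((1:ℝ) / ((d'+1 : ℕ) : ℝ)) with hTdef
  have hkpos : (0:ℝ) < k := by exact_mod_cast hk1
  have hTpos : 0 < T := by positivity
  have hTd : T^(d'+1) = k := hroot _ hkpos.le
  have hspos : 0 < σ * T := by positivity
  have hmpos : 0 < ⌈l * C * (σ * T)⌉₊ := Nat.ceil_pos.2 (by positivity)
  have hm1 := Nat.le_ceil (l * C * (σ * T))
  have hm2 := (Nat.ceil_lt_add_one (a := l * C * (σ * T)) (by positivity)).le
  set m := ⌈l * C * (σ * T)⌉₊ with hm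
  have hmpos' : (0:ℝ) < m := by exact_mod_cast hmpos
  apply bracket hΩ hlpos (by positivity : 0 < (σ * T)^2) hmpos
  · have hC2 : C^2 = 2^(d'+1) * ((d'+1 : ℕ) : ℝ) := Real.sq_sqrt (by positivity)
    have : (σ * T)^2 * (2^(d'+1) * (((d'+1 : ℕ) : ℝ) * (l/m)^2)) =
        (l * C * (σ * T) / m)^2 := by
      have h2 : (l * C * (σ * T) / m)^2 = C^2 * (l * (σ * T) / m)^2 := by ring
      rw [h2, hC2]; ring
    rw [this]
    apply pow_le_one₀ (by positivity)
    rwa [div_le_one hmpos']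
  · rw [Real.sqrt_sq hspos.le, ← hη, ← hV, ← hw]
    have e1 : V / l^(d'+1) * (w * (l * (σ * T) / π + √((d'+1 : ℕ) : ℝ))^(d'+1) / 2^(d'+1)) =
        k * (V * w * ((σ / π + √((d'+1 : ℕ) : ℝ) / l * T⁻¹) / 2)^(d'+1)) := by
      have : l * (σ * T) / π + √((d'+1 : ℕ) : ℝ) =
        l * T * 2 * ((σ / π + √((d'+1 : ℕ) : ℝ) / l * T⁻¹) / 2) := by field_simp
      rw [this, mul_pow _ ((σ / π + √((d'+1 : ℕ) : ℝ) / l * T⁻¹) / 2), mul_pow, mul_pow, hTd]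
      field_simp
    have e2 : η / l^(d'+1) * (m:ℝ)^(d'+1) ≤ k * (η * (C * σ + T⁻¹ / l)^(d'+1)) := by
      have e3 : l * C * (σ * T) + 1 = l * T * (C * σ + T⁻¹ / l) := by field_simp
      rw [e3] at hm2
      calc _ ≤ η / l^(d'+1) * (l * T * (C * σ + T⁻¹ / l))^(d'+1) := by gcongr
        _ = _ := by
          rw [mul_pow, mul_pow, hTd]; field_simp
    rw [e1]
    calc _ ≤ (k:ℝ) * F T⁻¹ := by simp only [hF]; linarith
      _ ≤ k * 1 := by gcongr
      _ = k := mul_one _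


theorem polya_main
    (d : ℕ) (hd : 2 ≤ d)
    (polya : ∀ k : ℕ, 1 ≤ k → ∀ Ω' : Set (Euc d), IsConvexDomain Ω' →
      neumannEigenvalue k Ω' * (volume Ω').toReal ^ ((2 : ℝ) / (d : ℝ)) ≤
        4 * Real.pi ^ 2 * (k : ℝ) ^ ((2 : ℝ) / (d : ℝ)) /
          (volume (Metric.ball (0 : Euc d) 1)).toReal ^ ((2 : ℝ) / (d : ℝ)))
    (Ω : Set (Euc d)) (hΩ : IsConvexDomain Ω)
    (Ωs : ℕ → Set (Euc d)) (hΩs : ∀ k : ℕ, 1 ≤ k → IsConvexDomain (Ωs k)) :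
    ∀ ε : ℝ, 0 < ε → ∃ K : ℕ, ∀ k : ℕ, K ≤ k →
      neumannEigenvalue k Ω * (volume Ω).toReal ^ ((2 : ℝ) / (d : ℝ)) ≥
        (1 - ε) *
          (neumannEigenvalue k (Ωs k) * (volume (Ωs k)).toReal ^ ((2 : ℝ) / (d : ℝ))) := by
  intro ε hε
  rcases le_or_gt 1 ε with h1 | h1
  · refine ⟨0, fun k _ => ?_⟩
    have a1 : 0 ≤ neumannEigenvalue k Ω * (volume Ω).toReal ^ ((2 : ℝ) / (d : ℝ)) :=
      mul_nonneg (neumann_nonneg k Ω) (by positivity)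
    have a2 : 0 ≤ neumannEigenvalue k (Ωs k) * (volume (Ωs k)).toReal ^ ((2 : ℝ) / (d : ℝ)) :=
      mul_nonneg (neumann_nonneg k _) (by positivity)
    nlinarith
  obtain ⟨d', rfl⟩ : ∃ d', d = d' + 1 := ⟨d - 1, by omega⟩
  have hq0 : 0 < √(1 - ε) := Real.sqrt_pos.2 (by linarith)
  have hq1 : √(1 - ε) < 1 := by rw [Real.sqrt_lt' one_pos]; linarith
  obtain ⟨K, hK⟩ := eventually_atTop.1 (weyl_lower hΩ hq0 hq1)
  refine ⟨max K 1, fun k hk => ?_⟩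
  have hk1 : 1 ≤ k := (le_max_right _ _).trans hk
  have hw := hK k ((le_max_left _ _).trans hk)
  have hp := polya k hk1 (Ωs k) (hΩs k hk1)
  obtain ⟨hne, ho, hb, hc⟩ := id hΩ
  have hVpos : 0 < (volume Ω).toReal :=
    ENNReal.toReal_pos (ho.measure_pos volume hne).ne' hb.measure_lt_top.ne
  have hwpos : 0 < (volume (Metric.ball (0 : Euc (d'+1)) 1)).toReal :=
    ENNReal.toReal_pos (Metric.measure_ball_pos volume 0 one_pos).ne' measure_ball_lt_top.ne
  have hkpos : (0:ℝ) < k := by exact_mod_cast hk1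
  have hsq : ∀ y : ℝ, 0 < y → (y ^ ((1:ℝ) / ((d'+1 : ℕ) : ℝ)))^2 =
      y ^ ((2:ℝ) / ((d'+1 : ℕ) : ℝ)) := by
    intro y hy
    rw [← Real.rpow_natCast, ← Real.rpow_mul hy.le]
    congr 1; push_cast; ring
  rw [mul_pow, div_pow, mul_pow, Real.sq_sqrt (by linarith), hsq _ hkpos,
    hsq _ (mul_pos hwpos hVpos), Real.mul_rpow hwpos.le hVpos.le] at hw
  have hVr : 0 < (volume Ω).toReal ^ ((2:ℝ) / ((d'+1 : ℕ) : ℝ)) := by positivity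
  have hwr : 0 < (volume (Metric.ball (0 : Euc (d'+1)) 1)).toReal ^ ((2:ℝ) / ((d'+1 : ℕ) : ℝ)) := by
    positivity
  calc _ ≤ (1 - ε) * _ := mul_le_mul_of_nonneg_left hp (by linarith)
    _ = _ := by
        rw [show (1 - ε) * (4 * Real.pi ^ 2 * (k : ℝ) ^ ((2 : ℝ) / ((d'+1 : ℕ) : ℝ)) /
          (volume (Metric.ball (0 : Euc (d'+1)) 1)).toReal ^ ((2 : ℝ) / ((d'+1 : ℕ) : ℝ))) =
          ((1 - ε) * (2 * π) ^ 2 /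
            ((volume (Metric.ball (0 : Euc (d'+1)) 1)).toReal ^ ((2:ℝ) / ((d'+1 : ℕ) : ℝ)) *
            (volume Ω).toReal ^ ((2:ℝ) / ((d'+1 : ℕ) : ℝ))) *
            (k:ℝ) ^ ((2:ℝ) / ((d'+1 : ℕ) : ℝ))) *
            (volume Ω).toReal ^ ((2:ℝ) / ((d'+1 : ℕ) : ℝ)) by
              field_simp; ring]
    _ ≤ _ := mul_le_mul_of_nonneg_right hw hVr.le

/-- Pólya's conjecture for the Neumann Laplacian implies the volume-adjusted
asymptotic quasi-monotonicity: if `μ_k(Ω')|Ω'|^{2/d} ≤ 4π²k^{2/d}/ω_d^{2/d}` for all `k ≥ 1`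
and all nonempty bounded convex open `Ω'`, then for every nonempty bounded convex open `Ω`
and every sequence `(Ω_k)` of nonempty bounded convex open sets,
`liminf_{k→∞} (μ_k(Ω)|Ω|^{2/d})/(μ_k(Ω_k)|Ω_k|^{2/d}) ≥ 1` in the precise `ε`-`K` sense. -/
theorem polya_implies_volume_adjusted_monotonicity
    (d : ℕ) (hd : 2 ≤ d)
    (polya : ∀ k : ℕ, 1 ≤ k → ∀ Ω' : Set (Euc d), IsConvexDomain Ω' →
      neumannEigenvalue k Ω' * (volume Ω').toReal ^ ((2 : ℝ) / (d : ℝ)) ≤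
        4 * Real.pi ^ 2 * (k : ℝ) ^ ((2 : ℝ) / (d : ℝ)) /
          (volume (Metric.ball (0 : Euc d) 1)).toReal ^ ((2 : ℝ) / (d : ℝ)))
    (Ω : Set (Euc d)) (hΩ : IsConvexDomain Ω)
    (Ωs : ℕ → Set (Euc d)) (hΩs : ∀ k : ℕ, 1 ≤ k → IsConvexDomain (Ωs k)) :
    ∀ ε : ℝ, 0 < ε → ∃ K : ℕ, ∀ k : ℕ, K ≤ k →
      neumannEigenvalue k Ω * (volume Ω).toReal ^ ((2 : ℝ) / (d : ℝ)) ≥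
        (1 - ε) *
          (neumannEigenvalue k (Ωs k) * (volume (Ωs k)).toReal ^ ((2 : ℝ) / (d : ℝ))) := by
  exact polya_main d hd polya Ω hΩ Ωs hΩs

end
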